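/- arXiv:math/0605056 — 2 statements merged into one kernel-verified Lean document; each statement's English description precedes it below -/
import Mathlib

section
/- Let S be a set, let Y be a positive integer, and let A be a nonempty set of finitely supported functions f : S → Z/2Z (f = 0̄ off a finite set). For a ∈ S, let f̄_a denote the function equal to f off a and with its value flipped at a. If for every f ∈ A there exist Y distinct points a_1, ..., a_Y ∈ S such that f̄_{a_i} ∈ A for every i = 1, ..., Y, then |A| ≥ 2^Y. -/
open MeasureTheory
open scoped ENNReal

namespace Perco

/-- Vertices of the lattice `Z^d`. -/
abbrev Zd (d : ℕ) := Fin d → ℤ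

/-- A percolation configuration: each (unordered) edge of the lattice is open or closed.
(Only the values on nearest-neighbour pairs matter.) -/
abbrev Config (d : ℕ) := Sym2 (Zd d) → Bool

/-- Lattice adjacency: `(x,y) ∈ E^d`. -/
def latAdj {d : ℕ} (x y : Zd d) : Prop := (∑ i, |x i - y i|) = 1

/-- Open adjacency in the configuration `ω`. -/
def openAdj {d : ℕ} (ω : Config d) (x y : Zd d) : Prop :=
  latAdj x y ∧ ω s(x, y) = true

/-- `C`: the open cluster of the origin. -/
def cluster {d : ℕ} (ω : Config d) : Set (Zd d) :=
  {y | Relation.ReflTransGen (openAdj ω) 0 y}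

/-- `Q` is the product measure making the edge states i.i.d. Bernoulli(p). -/
def IsBernoulli {d : ℕ} (p : ℝ) (Q : Measure (Config d)) : Prop :=
  IsProbabilityMeasure Q ∧
    ∀ (s : Finset (Sym2 (Zd d))) (f : Sym2 (Zd d) → Bool),
      Q {ω : Config d | ∀ e ∈ s, ω e = f e} =
        ∏ e ∈ s, (if f e then ENNReal.ofReal p else ENNReal.ofReal (1 - p))

/-- The critical probability `p_c`. -/
noncomputable def pc (d : ℕ) : ℝ :=
  sSup {p : ℝ | 0 ≤ p ∧ p ≤ 1 ∧
    ∀ Q : Measure (Config d), IsBernoulli p Q → Q {ω | (cluster ω).Infinite} = 0}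

/-- The box `B_n = [-n,n]^d`. -/
def box (d n : ℕ) : Set (Zd d) := {x | ∀ i, |x i| ≤ (n : ℤ)}

/-- `C_n`: the connected component of `0` in `C ∩ B_n`. -/
def clusterN {d : ℕ} (ω : Config d) (n : ℕ) : Set (Zd d) :=
  {y | Relation.ReflTransGen
    (fun a b => openAdj ω a b ∧ a ∈ box d n ∧ b ∈ box d n) 0 y}

/-- `A` is connected in the open subgraph. -/
def ConnOpen {d : ℕ} (ω : Config d) (A : Set (Zd d)) : Prop :=
  ∀ x ∈ A, ∀ y ∈ A,
    Relation.ReflTransGen (fun a b => openAdj ω a b ∧ a ∈ A ∧ b ∈ A) x y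

/-- `A` is connected in the lattice. -/
def ConnLat {d : ℕ} (A : Set (Zd d)) : Prop :=
  ∀ x ∈ A, ∀ y ∈ A,
    Relation.ReflTransGen (fun a b => latAdj a b ∧ a ∈ A ∧ b ∈ A) x y

/-- The boundary `∂_{C^g} A` = open lattice edges from `A` to its complement. -/
def bdry {d : ℕ} (ω : Config d) (A : Set (Zd d)) : Set (Zd d × Zd d) :=
  {e | openAdj ω e.1 e.2 ∧ e.1 ∈ A ∧ e.2 ∉ A}

/-- The profile `f_c` (at scale `n`, exponent `γ`). -/
noncomputable def fcut (d : ℕ) (γ c : ℝ) (n : ℕ) (x : ℝ) : ℝ :=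
  if x < c * (n : ℝ) ^ γ then 1 else x ^ (1 - 1 / (d : ℝ))

/-- `ν(x)`: number of open neighbours of `x`. -/
noncomputable def nu {d : ℕ} (ω : Config d) (x : Zd d) : ℕ :=
  Set.ncard {y | openAdj ω x y}

-- Transition kernel of the simple random walk on the open subgraph.
open Classical in
noncomputable def step {d : ℕ} (ω : Config d) (x y : Zd d) : ℝ :=
  if openAdj ω x y then ((nu ω x : ℝ))⁻¹ else 0

/-- Weight of a path of length `n`. -/
noncomputable def pathW {d n : ℕ} (ω : Config d) (γ : Fin (n + 1) → Zd d) : ℝ :=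
  ∏ i : Fin n, step ω (γ i.castSucc) (γ i.succ)

/-- `N_n`: number of distinct sites visited by the path. -/
noncomputable def visits {d n : ℕ} (γ : Fin (n + 1) → Zd d) : ℕ :=
  (Set.range γ).ncard

/-- `P_0^ω(E)`, the probability of a path event for the walk started at 0. -/
noncomputable def PWalk {d : ℕ} (ω : Config d) (n : ℕ)
    (E : (Fin (n + 1) → Zd d) → Prop) : ℝ :=
  ∑' γ : Fin (n + 1) → Zd d,
    Set.indicator {γ | γ 0 = 0 ∧ E γ} (fun γ => pathW ω γ) γ

/-- `E_0^ω(α^{N_n})`. -/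
noncomputable def LaplaceN {d : ℕ} (ω : Config d) (α : ℝ) (n : ℕ) : ℝ :=
  ∑' γ : Fin (n + 1) → Zd d,
    Set.indicator {γ | γ 0 = 0} (fun γ => pathW ω γ * α ^ visits γ) γ

/-- `E_0^ω(α^{N_n} 1_{X_n = 0})`. -/
noncomputable def LaplaceNReturn {d : ℕ} (ω : Config d) (α : ℝ) (n : ℕ) : ℝ :=
  ∑' γ : Fin (n + 1) → Zd d,
    Set.indicator {γ | γ 0 = 0 ∧ γ (Fin.last n) = 0}
      (fun γ => pathW ω γ * α ^ visits γ) γ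

/-- Vertices of the wreath product `C^g ≀ Z/2Z` (lamplighter states). -/
abbrev Lamp (d : ℕ) := Zd d × (Zd d →₀ ZMod 2)

/-- Flip a lamp configuration at one point. -/
noncomputable def flipAt {σ : Type*} (f : σ →₀ ZMod 2) (x : σ) : σ →₀ ZMod 2 :=
  f + Finsupp.single x 1

/-- Transition kernel of the lamplighter walk `Z` with parameter `α`. -/
noncomputable def ptilde {d : ℕ} (ω : Config d) (α : ℝ) (u v : Lamp d) : ℝ :=
  Set.indicator
    {q : Lamp d × Lamp d | ∀ x, x ≠ q.1.1 → x ≠ q.2.1 → q.1.2 x = q.2.2 x}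
    (fun q => (if q.2.2 q.1.1 = 0 then α else 1 - α) *
      (if q.2.2 q.2.1 = 0 then α else 1 - α) * step ω q.1.1 q.2.1) (u, v)

/-- `P̃_o^ω(Z_n = o)`: return probability of the lamplighter walk. -/
noncomputable def ZReturn {d : ℕ} (ω : Config d) (α : ℝ) (n : ℕ) : ℝ :=
  ∑' γ : Fin (n + 1) → Lamp d,
    Set.indicator {γ | γ 0 = (0, 0) ∧ γ (Fin.last n) = (0, 0)}
      (fun γ => ∏ i : Fin n, ptilde ω α (γ i.castSucc) (γ i.succ)) γ

/-- Vertex set of the wreath product over a vertex set `V` of the base. -/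
def wVert {d : ℕ} (V : Set (Zd d)) : Set (Lamp d) :=
  {u | u.1 ∈ V ∧ ↑u.2.support ⊆ V}

/-- Adjacency in the wreath product `C^g ≀ Z/2Z`. -/
def wAdj {d : ℕ} (ω : Config d) (u v : Lamp d) : Prop :=
  (u.1 = v.1 ∧ (∀ x, x ≠ u.1 → u.2 x = v.2 x) ∧ u.2 u.1 ≠ v.2 u.1) ∨
    (u.2 = v.2 ∧ openAdj ω u.1 v.1)

/-- Boundary of `U` in the wreath product `C^g ≀ Z/2Z`. -/
def wBdry {d : ℕ} (ω : Config d) (U : Set (Lamp d)) : Set (Lamp d × Lamp d) :=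
  {e | e.1 ∈ U ∧ e.2 ∈ wVert (cluster ω) \ U ∧ wAdj ω e.1 e.2}

/-- Følner function `Fol_{C_n^g}^{C^g}` (with value `⊤` when no set qualifies). -/
noncomputable def FolC {d : ℕ} (ω : Config d) (n : ℕ) (k : ℝ) : ℝ≥0∞ :=
  sInf {m : ℝ≥0∞ | ∃ A : Set (Zd d), A ⊆ clusterN ω n ∧ A.Nonempty ∧
    ((bdry ω A).ncard : ℝ) / (A.ncard : ℝ) ≤ 1 / k ∧ m = (A.ncard : ℝ≥0∞)}

/-- Følner function `Fol_{C_n^g ≀ Z/2Z}^{C^g ≀ Z/2Z}`. -/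
noncomputable def FolW {d : ℕ} (ω : Config d) (n : ℕ) (k : ℝ) : ℝ≥0∞ :=
  sInf {m : ℝ≥0∞ | ∃ U : Set (Lamp d), U ⊆ wVert (clusterN ω n) ∧ U.Nonempty ∧
    ((wBdry ω U).ncard : ℝ) / (U.ncard : ℝ) ≤ 1 / k ∧ m = (U.ncard : ℝ≥0∞)}

/-- Degree of a configuration `f` in the graph `K_U`. -/
noncomputable def Kdeg {d : ℕ} (U : Set (Lamp d)) (f : Zd d →₀ ZMod 2) : ℕ :=
  Set.ncard {g : Zd d →₀ ZMod 2 | ∃ x : Zd d, (x, f) ∈ U ∧ (x, g) ∈ U ∧ g = flipAt f x}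

/-- A point `u = (x,f)` of `U` is bad if `(x, f̄_x) ∉ U`. -/
def badPt {d : ℕ} (U : Set (Lamp d)) (u : Lamp d) : Prop :=
  (u.1, flipAt u.2 u.1) ∉ U

/-- `D(0,x) ≤ r`: the chemical distance from the origin to `x` is at most `r`. -/
def chemLE {d : ℕ} (ω : Config d) (x : Zd d) (r : ℕ) : Prop :=
  ∃ m ≤ r, ∃ γ : ℕ → Zd d, γ 0 = 0 ∧ γ m = x ∧ ∀ i < m, openAdj ω (γ i) (γ (i + 1))

/-- `B_r(C)`: chemical ball of radius `r` around the origin. -/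
def chemBall {d : ℕ} (ω : Config d) (r : ℕ) : Set (Zd d) := {x | chemLE ω x r}

/-- Lattice connected component of `x` inside a vertex set `V`. -/
def latCompIn {d : ℕ} (V : Set (Zd d)) (x : Zd d) : Set (Zd d) :=
  {y | Relation.ReflTransGen (fun a b => latAdj a b ∧ a ∈ V ∧ b ∈ V) x y}

/-- Open connected component of `x` inside a vertex set `V`. -/
def openCompIn {d : ℕ} (ω : Config d) (V : Set (Zd d)) (x : Zd d) : Set (Zd d) :=
  {y | Relation.ReflTransGen (fun a b => openAdj ω a b ∧ a ∈ V ∧ b ∈ V) x y}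

/-- `L_n`: a connected component of the open subgraph inside `B_n` of maximal cardinality. -/
def IsLargestComp {d : ℕ} (ω : Config d) (n : ℕ) (L : Set (Zd d)) : Prop :=
  (∃ x ∈ box d n, L = openCompIn ω (box d n) x) ∧
    ∀ y ∈ box d n, (openCompIn ω (box d n) y).ncard ≤ L.ncard

/-- `\bar L`: the connected component of `L` in the full open subgraph. -/
def closureOf {d : ℕ} (ω : Config d) (L : Set (Zd d)) : Set (Zd d) :=
  {y | ∃ x ∈ L, Relation.ReflTransGen (openAdj ω) x y}

/-- The boundary `∂_{\bar L_n^g} A`. -/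
def bdryBar {d : ℕ} (ω : Config d) (n : ℕ) (L A : Set (Zd d)) : Set (Zd d × Zd d) :=
  {e | openAdj ω e.1 e.2 ∧ e.1 ∈ A ∩ closureOf ω L ∧ e.2 ∈ box d (n + 1) \ A}

/-- `n(A)`: number of connected components of `B_n − L` containing a component of `A`. -/
noncomputable def nComp {d : ℕ} (n : ℕ) (L A : Set (Zd d)) : ℕ :=
  Set.ncard {P : Set (Zd d) |
    (∃ x ∈ box d n \ L, P = latCompIn (box d n \ L) x) ∧
    ∃ x ∈ A, latCompIn A x ⊆ P}

/-- The killed kernel `P^{B_r(C)}` acting on functions. -/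
noncomputable def Pball {d : ℕ} (ω : Config d) (r : ℕ) (f : Zd d → ℝ) : Zd d → ℝ :=
  Set.indicator (chemBall ω r) (fun x =>
    ∑' y : Zd d, Set.indicator (chemBall ω r) (fun y => step ω x y * f y) y)

/-- The Dirichlet form `ξ(f,f) = ((Id − P^{B_r(C)}) 1_{B_r(C)} f | f)_ν`. -/
noncomputable def dirichletForm {d : ℕ} (ω : Config d) (r : ℕ) (f : Zd d → ℝ) : ℝ :=
  ∑' x : Zd d, (nu ω x : ℝ) * f x *
    (Set.indicator (chemBall ω r) f x - Pball ω r (Set.indicator (chemBall ω r) f) x)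

/-- `‖f‖²_{l²(ν)}`. -/
noncomputable def normSq {d : ℕ} (ω : Config d) (f : Zd d → ℝ) : ℝ :=
  ∑' x : Zd d, (nu ω x : ℝ) * f x ^ 2

/-- `λ_1(B_r(C))`: smallest Dirichlet eigenvalue of the killed walk. -/
noncomputable def lambda1 {d : ℕ} (ω : Config d) (r : ℕ) : ℝ :=
  sInf {t : ℝ | ∃ f : Zd d → ℝ, f ≠ 0 ∧ Function.support f ⊆ chemBall ω r ∧
    t = dirichletForm ω r f / normSq ω f}

theorem flipAt_apply_of_ne {σ : Type*} (f : σ →₀ ZMod 2) {x y : σ} (hxy : x ≠ y) :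
    flipAt f x y = f y := by
  simp [flipAt, Finsupp.single_eq_of_ne' hxy]

theorem flipAt_apply_self_ne {σ : Type*} (f : σ →₀ ZMod 2) (x : σ) :
    flipAt f x x ≠ f x := by
  simp [flipAt]

/-- A nonempty set of lamp configurations, each having at least `n` flips inside the set,
has at least `2 ^ n` elements. -/
theorem two_pow_le_encard_of_flipAt_mem {S : Type*} (n : ℕ) (A : Set (S →₀ ZMod 2))
    (hA : A.Nonempty)
    (h : ∀ f ∈ A, ∃ T : Finset S, n ≤ T.card ∧ ∀ a ∈ T, flipAt f a ∈ A) :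
    (2 : ℕ∞) ^ n ≤ A.encard := by
  classical
  induction n generalizing A with
  | zero => simpa [Set.one_le_encard_iff_nonempty] using hA
  | succ n ih =>
    obtain ⟨f, hf⟩ := hA
    obtain ⟨T, hT, hfT⟩ := h f hf
    obtain ⟨a, ha⟩ : T.Nonempty := Finset.card_pos.mp (by omega)
    have erase_flips : ∀ g ∈ A, ∃ T : Finset S, n ≤ T.card ∧
        ∀ b ∈ T, flipAt g b ∈ A ∧ flipAt g b a = g a := by
      intro g hg
      obtain ⟨T, hT, hgT⟩ := h g hg
      refine ⟨T.erase a, by have := Finset.pred_card_le_card_erase (s := T) (a := a); omega,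
        fun b hb => ?_⟩
      exact ⟨hgT b (Finset.mem_of_mem_erase hb),
        flipAt_apply_of_ne g (Finset.ne_of_mem_erase hb)⟩
    have h_same : (2 : ℕ∞) ^ n ≤ (A ∩ {g | g a = f a}).encard := by
      refine ih _ ⟨f, hf, rfl⟩ fun g ⟨hg, hga⟩ => ?_
      obtain ⟨T, hT, hgT⟩ := erase_flips g hg
      exact ⟨T, hT, fun b hb => ⟨(hgT b hb).1, (hgT b hb).2.trans hga⟩⟩
    have h_flipped : (2 : ℕ∞) ^ n ≤ (A \ {g | g a = f a}).encard := by
      refine ih _ ⟨flipAt f a, hfT a ha, flipAt_apply_self_ne f a⟩ fun g ⟨hg, hga⟩ => ?_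
      obtain ⟨T, hT, hgT⟩ := erase_flips g hg
      exact ⟨T, hT, fun b hb => ⟨(hgT b hb).1, fun hb' => hga ((hgT b hb).2.symm.trans hb')⟩⟩
    calc (2 : ℕ∞) ^ (n + 1) = 2 ^ n + 2 ^ n := by rw [pow_succ, mul_two]
      _ ≤ (A \ {g | g a = f a}).encard + (A ∩ {g | g a = f a}).encard :=
        add_le_add h_flipped h_same
      _ = A.encard := Set.encard_sdiff_add_encard_inter A _

/-- a set of lamp configurations with `Y` free flips has at least `2^Y` elements. -/
theorem stmt6 {S : Type*} (Y : ℕ) (hY : 0 < Y)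
    (A : Set (S →₀ ZMod 2)) (hA : A.Nonempty)
    (h : ∀ f ∈ A, ∃ T : Finset S, T.card = Y ∧ ∀ a ∈ T, flipAt f a ∈ A) :
    (2 : ℕ∞) ^ Y ≤ A.encard := by
  refine two_pow_le_encard_of_flipAt_mem Y A hA fun f hf => ?_
  obtain ⟨T, hT, hfT⟩ := h f hf
  exact ⟨T, hT.ge, hfT⟩

end Perco
end

section
/- Let d ≥ 2 and γ > 0. There exists p_0 < 1 such that for every p ∈ [p_0, 1]: there exists β > 0 such that for every c > 0, Q-almost surely there exists n_{ω,c} such that for all n ≥ n_{ω,c} and every connected subset A of B_n: (n(A) + |∂_{\bar{L}_n^g} A|) / f_c(|A|) ≥ β. -/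
open MeasureTheory
open scoped ENNReal

namespace Perco

/-- The `i`-th unit vector. -/
abbrev unitVec {d : ℕ} (i : Fin d) : Zd d := Pi.single i 1

lemma latAdj_symm {d : ℕ} {x y : Zd d} (h : latAdj x y) : latAdj y x := by
  unfold latAdj at *
  simpa only [abs_sub_comm] using h

lemma latAdj_add_unitVec {d : ℕ} (x : Zd d) (i : Fin d) : latAdj x (x + unitVec i) := by
  unfold latAdj
  rw [Finset.sum_eq_single i]
  · simp
  · intro j _ hj
    simp [hj]
  · simp

lemma latAdj_iff {d : ℕ} {x y : Zd d} :
    latAdj x y ↔ ∃ i, y = x + unitVec i ∨ x = y + unitVec i := by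
  constructor
  · intro h
    have h' : ∑ i, |x i - y i| = 1 := h
    have hne : ∃ i, x i - y i ≠ 0 := by
      by_contra! hc
      simp [hc] at h'
    obtain ⟨i, hi⟩ := hne
    have hpos : 1 ≤ |x i - y i| := Int.one_le_abs hi
    have hsum := Finset.add_sum_erase Finset.univ (fun j => |x j - y j|) (Finset.mem_univ i)
    simp only [h'] at hsum
    have hnn : 0 ≤ ∑ j ∈ Finset.univ.erase i, |x j - y j| :=
      Finset.sum_nonneg fun _ _ => abs_nonneg _
    have hz : ∑ j ∈ Finset.univ.erase i, |x j - y j| = 0 := by omega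
    have h1 : |x i - y i| = 1 := by omega
    rw [Finset.sum_eq_zero_iff_of_nonneg (fun _ _ => abs_nonneg _)] at hz
    have hj : ∀ j, j ≠ i → x j = y j := fun j hj => by
      have := hz j (by simp [hj])
      rw [abs_eq_zero] at this
      omega
    refine ⟨i, ?_⟩
    rcases (abs_eq (by norm_num : (0 : ℤ) ≤ 1)).1 h1 with h2 | h2
    · right
      funext j
      by_cases hji : j = i
      · subst hji; simp; omega
      · simp [hji, hj j hji]
    · left
      funext j
      by_cases hji : j = i
      · subst hji; simp; omega
      · simp [hji, hj j hji]
  · rintro ⟨i, rfl | rfl⟩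
    · exact latAdj_add_unitVec x i
    · exact latAdj_symm (latAdj_add_unitVec y i)

lemma abs_sub_le_one_of_latAdj {d : ℕ} {x y : Zd d} (h : latAdj x y) (i : Fin d) :
    |x i - y i| ≤ 1 := by
  have h' : ∑ i, |x i - y i| = 1 := h
  rw [← h']
  exact Finset.single_le_sum (f := fun i => |x i - y i|) (fun _ _ => abs_nonneg _)
    (Finset.mem_univ i)

/-- A predicate that changes between two points changes across a lattice edge of the
rectangle that they span. -/
lemma exists_crossing {d : ℕ} (P : Zd d → Prop) {z y : Zd d} (hz : P z) (hy : ¬ P y) :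
    ∃ w w', latAdj w w' ∧ P w ∧ ¬ P w' ∧
      ∀ k, (min (z k) (y k) ≤ w k ∧ w k ≤ max (z k) (y k)) ∧
        (min (z k) (y k) ≤ w' k ∧ w' k ≤ max (z k) (y k)) := by
  induction hN : ∑ k, (z k - y k).natAbs using Nat.strong_induction_on generalizing z with
  | _ N ih =>
    have hne : ∃ k, z k ≠ y k := by
      by_contra! hc
      exact hy ((funext hc : z = y) ▸ hz)
    obtain ⟨k, hk⟩ := hne
    obtain ⟨z', hadj, hlt, hk', hoth⟩ : ∃ z' : Zd d, latAdj z z' ∧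
        (z' k - y k).natAbs < (z k - y k).natAbs ∧
        (min (z k) (y k) ≤ z' k ∧ z' k ≤ max (z k) (y k)) ∧ ∀ j, j ≠ k → z' j = z j := by
      rcases lt_or_gt_of_ne hk with h | h
      · refine ⟨z + unitVec k, latAdj_add_unitVec z k, ?_, ?_, ?_⟩
        · simp; omega
        · simp; omega
        · intro j hj; simp [hj]
      · refine ⟨z - unitVec k, latAdj_symm ?_, ?_, ?_, ?_⟩
        · simpa using latAdj_add_unitVec (z - unitVec k) k
        · simp; omega
        · simp; omega
        · intro j hj; simp [hj]
    have hz' : ∀ j, min (z j) (y j) ≤ z' j ∧ z' j ≤ max (z j) (y j) := by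
      intro j
      by_cases hj : j = k
      · subst hj; exact hk'
      · rw [hoth j hj]; simp
    by_cases hP : P z'
    · have hs : ∑ k, (z' k - y k).natAbs < N := by
        rw [← hN]
        refine Finset.sum_lt_sum (fun j _ => ?_) ⟨k, Finset.mem_univ k, hlt⟩
        by_cases hj : j = k
        · subst hj; exact hlt.le
        · rw [hoth j hj]
      obtain ⟨w, w', h1, h2, h3, h4⟩ := ih _ hs hP rfl
      refine ⟨w, w', h1, h2, h3, fun j => ?_⟩
      have := h4 j
      have := hz' j
      omega
    · exact ⟨z, z', hadj, hz, hP, fun j => ⟨by simp, hz' j⟩⟩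

lemma mem_latCompIn_self {d : ℕ} (V : Set (Zd d)) (x : Zd d) : x ∈ latCompIn V x :=
  Relation.ReflTransGen.refl

lemma latCompIn_subset {d : ℕ} {V : Set (Zd d)} {x : Zd d} (hx : x ∈ V) :
    latCompIn V x ⊆ V := by
  intro y hy
  rcases Relation.ReflTransGen.cases_tail hy with h | ⟨_, _, h⟩
  · exact h ▸ hx
  · exact h.2.2

lemma latCompIn_closed {d : ℕ} {V : Set (Zd d)} {x a b : Zd d} (hx : x ∈ V)
    (ha : a ∈ latCompIn V x) (hab : latAdj a b) (hb : b ∈ V) : b ∈ latCompIn V x :=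
  Relation.ReflTransGen.tail ha ⟨hab, latCompIn_subset hx ha, hb⟩

lemma ConnLat.exists_adj {d : ℕ} {A : Set (Zd d)} (hA : ConnLat A) (P : Zd d → Prop) {x y : Zd d}
    (hx : x ∈ A) (hy : y ∈ A) (hPx : P x) (hPy : ¬ P y) :
    ∃ a ∈ A, ∃ b ∈ A, latAdj a b ∧ P a ∧ ¬ P b := by
  have h := hA x hx y hy
  induction h with
  | refl => exact absurd hPx hPy
  | @tail b c _ hbc ih =>
    by_cases hPb : P b
    · exact ⟨b, hbc.2.1, c, hbc.2.2, hbc.1, hPb, hPy⟩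
    · exact ih hbc.2.1 hPb

/-- A set is connected as soon as a property stable under adjacency within it,
holding at one point, holds everywhere. -/
lemma connLat_of_forall {d : ℕ} {A : Set (Zd d)}
    (h : ∀ P : Zd d → Prop, ∀ x ∈ A, ∀ y ∈ A, P x → ¬ P y →
      ∃ a ∈ A, ∃ b ∈ A, latAdj a b ∧ P a ∧ ¬ P b) : ConnLat A := by
  intro x hx y hy
  by_contra hc
  obtain ⟨a, ha, b, hb, hab, hPa, hPb⟩ := h (· ∈ latCompIn A x) x hx y hy
    (mem_latCompIn_self _ _) hc
  exact hPb (latCompIn_closed hx hPa hab hb)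

lemma connLat_latCompIn {d : ℕ} {V : Set (Zd d)} {x : Zd d} (hx : x ∈ V) :
    ConnLat (latCompIn V x) := by
  have key : ∀ y ∈ latCompIn V x, Relation.ReflTransGen
      (fun a b => latAdj a b ∧ a ∈ latCompIn V x ∧ b ∈ latCompIn V x) x y := by
    intro y hy
    induction hy with
    | refl => exact .refl
    | @tail b c hb hbc ih =>
      exact ih.tail ⟨hbc.1, hb, latCompIn_closed hx hb hbc.1 hbc.2.2⟩
  intro a ha b hb
  refine Relation.ReflTransGen.trans ?_ (key b hb)
  have := key a ha
  rw [← Relation.reflTransGen_swap] at this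
  refine Relation.ReflTransGen.mono ?_ _ _ this
  exact fun u v h => ⟨latAdj_symm h.1, h.2.2, h.2.1⟩

lemma ConnLat.subset_latCompIn {d : ℕ} {A V : Set (Zd d)} (hA : ConnLat A) (hAV : A ⊆ V)
    {x : Zd d} (hx : x ∈ A) : A ⊆ latCompIn V x := by
  intro y hy
  refine Relation.ReflTransGen.mono ?_ _ _ (hA x hx y hy)
  exact fun _ _ h => ⟨h.1, hAV h.2.1, hAV h.2.2⟩

/-- Connected sets have the intermediate value property in each coordinate. -/
lemma ConnLat.exists_coord {d : ℕ} {A : Set (Zd d)} (hA : ConnLat A) {x y : Zd d} (hx : x ∈ A)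
    (hy : y ∈ A) (i : Fin d) {t : ℤ} (h1 : x i ≤ t) (h2 : t ≤ y i) : ∃ z ∈ A, z i = t := by
  by_cases hyt : y i ≤ t
  · exact ⟨y, hy, by omega⟩
  obtain ⟨a, ha, b, hb, hab, hPa, hPb⟩ := hA.exists_adj (fun z => z i ≤ t) hx hy h1 hyt
  have := abs_sub_le_one_of_latAdj hab i
  rw [abs_le] at this
  exact ⟨a, ha, by omega⟩

lemma ConnLat.coord_lt_ncard {d : ℕ} {A : Set (Zd d)} (hA : ConnLat A) (hfin : A.Finite)
    {x y : Zd d} (hx : x ∈ A) (hy : y ∈ A) (i : Fin d) : y i - x i + 1 ≤ A.ncard := by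
  have hsub : ((Finset.Icc (x i) (y i) : Finset ℤ) : Set ℤ) ⊆ (fun z : Zd d => z i) '' A := by
    intro t ht
    rw [Finset.coe_Icc, Set.mem_Icc] at ht
    obtain ⟨z, hz, hzt⟩ := hA.exists_coord hx hy i ht.1 ht.2
    exact ⟨z, hz, hzt⟩
  have h1 := Set.ncard_le_ncard hsub (hfin.image _)
  rw [Set.ncard_coe_finset, Int.card_Icc] at h1
  have h2 := Set.ncard_image_le (f := fun z : Zd d => z i) hfin
  omega

lemma mem_box {d n : ℕ} {x : Zd d} : x ∈ box d n ↔ ∀ i, -(n : ℤ) ≤ x i ∧ x i ≤ n := by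
  simp [box, abs_le]

/-- The box as a finset. -/
noncomputable def boxF (d n : ℕ) : Finset (Zd d) := Fintype.piFinset fun _ => Finset.Icc (-(n : ℤ)) n

lemma coe_boxF (d n : ℕ) : (boxF d n : Set (Zd d)) = box d n := by
  ext x
  simp [boxF, mem_box, Pi.le_def, forall_and]

lemma mem_boxF {d n : ℕ} {x : Zd d} : x ∈ boxF d n ↔ x ∈ box d n := by
  rw [← Finset.mem_coe, coe_boxF]

lemma box_finite (d n : ℕ) : (box d n).Finite := coe_boxF d n ▸ Finset.finite_toSet _

lemma card_boxF (d n : ℕ) : (boxF d n).card = (2 * n + 1) ^ d := by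
  rw [boxF, Fintype.card_piFinset]
  simp
  congr 1
  omega

lemma mem_box_of_between {d n : ℕ} {z y w : Zd d} (hz : z ∈ box d n) (hy : y ∈ box d n)
    (h : ∀ k, min (z k) (y k) ≤ w k ∧ w k ≤ max (z k) (y k)) : w ∈ box d n := by
  rw [mem_box] at *
  intro k
  have := hz k
  have := hy k
  have := h k
  omega

/-- A set that contains the rectangle spanned by any two of its points is connected. -/
lemma connLat_of_ordConnected {d : ℕ} {A : Set (Zd d)}
    (h : ∀ z ∈ A, ∀ y ∈ A, ∀ w : Zd d,
      (∀ k, min (z k) (y k) ≤ w k ∧ w k ≤ max (z k) (y k)) → w ∈ A) : ConnLat A := by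
  refine connLat_of_forall fun P x hx y hy hPx hPy => ?_
  obtain ⟨w, w', h1, h2, h3, h4⟩ := exists_crossing P hPx hPy
  exact ⟨w, h x hx y hy w fun k => (h4 k).1, w', h x hx y hy w' fun k => (h4 k).2, h1, h2, h3⟩

/-- The points of the box with a coordinate of maximal modulus. -/
def shell (d n : ℕ) : Set (Zd d) := {x | x ∈ box d n ∧ ∃ i, |x i| = n}

lemma connLat_shell {d : ℕ} (hd : 2 ≤ d) (n : ℕ) : ConnLat (shell d n) := by
  classical
  set c : Zd d := fun _ => (n : ℤ) with hc
  have hcb : c ∈ box d n := by rw [mem_box]; intro i; simp [hc]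
  have hcs : c ∈ shell d n := ⟨hcb, ⟨0, by omega⟩, by simp [hc]⟩
  have key : ∀ x ∈ shell d n, x ∈ latCompIn (shell d n) c := by
    rintro x ⟨hxb, i, hi⟩
    by_contra hx
    have hxb' := mem_box.1 hxb
    set z : Zd d := Function.update c i (x i) with hz
    have hzb : z ∈ box d n := by
      rw [mem_box]; intro k
      by_cases hk : k = i
      · subst hk; simpa [hz] using hxb' k
      · simp [hz, hk, hc]
    by_cases hzC : z ∈ latCompIn (shell d n) c
    · obtain ⟨w, w', h1, h2, h3, h4⟩ :=
        exists_crossing (· ∈ latCompIn (shell d n) c) hzC hx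
      refine h3 (latCompIn_closed hcs h2 h1 ⟨mem_box_of_between hzb hxb fun k => (h4 k).2, i, ?_⟩)
      have := (h4 i).2
      simp only [hz, Function.update_self, min_self, max_self] at this
      rw [← hi]; congr 1; omega
    · obtain ⟨j, hj⟩ : ∃ j : Fin d, j ≠ i := by
        have : Nontrivial (Fin d) := Fin.nontrivial_iff_two_le.2 hd
        exact exists_ne i
      obtain ⟨w, w', h1, h2, h3, h4⟩ :=
        exists_crossing (· ∈ latCompIn (shell d n) c) (mem_latCompIn_self _ _) hzC
      refine h3 (latCompIn_closed hcs h2 h1 ⟨mem_box_of_between hcb hzb fun k => (h4 k).2, j, ?_⟩)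
      have := (h4 j).2
      simp only [hz, Function.update_of_ne hj, min_self, max_self, hc] at this
      rw [show w' j = (n : ℤ) by omega]; simp
  refine connLat_of_forall fun P x hx y hy hPx hPy => ?_
  have hconn := connLat_latCompIn hcs
  obtain ⟨a, ha, b, hb, h⟩ := hconn.exists_adj P (key x hx) (key y hy) hPx hPy
  exact ⟨a, latCompIn_subset hcs ha, b, latCompIn_subset hcs hb, h⟩

/-- The component of `V` in the complement of a connected set `U` in the box has connected
complement, and its boundary edges end in `U`. -/
lemma exists_cut {d n : ℕ} {U V : Set (Zd d)} (hU : ConnLat U) (hUb : U ⊆ box d n)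
    (hUne : U.Nonempty) (hV : ConnLat V) (hVb : V ⊆ box d n) (hVne : V.Nonempty)
    (hUV : Disjoint U V) :
    ∃ D ⊆ box d n, V ⊆ D ∧ Disjoint U D ∧ ConnLat D ∧ ConnLat (box d n \ D) ∧
      ∀ x ∈ D, ∀ y ∈ box d n \ D, latAdj x y → y ∈ U := by
  obtain ⟨v, hv⟩ := hVne
  have hvV : v ∈ box d n \ U := ⟨hVb hv, fun h => (hUV.le_bot ⟨h, hv⟩).elim⟩
  set D := latCompIn (box d n \ U) v with hD
  have hDs : D ⊆ box d n \ U := latCompIn_subset hvV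
  have hbd : ∀ x ∈ D, ∀ y ∈ box d n \ D, latAdj x y → y ∈ U := by
    intro x hx y hy hxy
    by_contra hyU
    exact hy.2 (latCompIn_closed hvV hx hxy ⟨hy.1, hyU⟩)
  have hUD : Disjoint U D := Set.disjoint_left.2 fun x hx hx' => (hDs hx').2 hx
  have hUF : U ⊆ box d n \ D := fun x hx => ⟨hUb hx, Set.disjoint_left.1 hUD hx⟩
  refine ⟨D, fun x hx => (hDs hx).1, ?_, hUD, connLat_latCompIn hvV, ?_, hbd⟩
  · refine hV.subset_latCompIn (V := box d n \ U)
      (fun x hx => ⟨hVb hx, fun h => (hUV.le_bot ⟨h, hx⟩).elim⟩) hv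
  · set F := box d n \ D with hF
    have hit : ∀ y ∈ F, ∃ u ∈ U, u ∈ latCompIn F y := by
      intro y hy
      by_contra! hc
      obtain ⟨u, hu⟩ := hUne
      obtain ⟨w, w', h1, h2, h3, h4⟩ :=
        exists_crossing (· ∈ latCompIn F y) (mem_latCompIn_self _ _) (hc u hu)
      have hw'b : w' ∈ box d n := mem_box_of_between hy.1 (hUb hu) fun k => (h4 k).2
      have hwF := latCompIn_subset hy h2
      by_cases hw'D : w' ∈ D
      · exact hc w (hbd w' hw'D w hwF (latAdj_symm h1)) h2
      · exact h3 (latCompIn_closed hy h2 h1 ⟨hw'b, hw'D⟩)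
    refine connLat_of_forall fun P x hx y hy hPx hPy => ?_
    obtain ⟨u, hu, hux⟩ := hit x hx
    obtain ⟨v', hv', hvy⟩ := hit y hy
    have aux : ∀ B : Set (Zd d), B ⊆ F → ConnLat B → ∀ a ∈ B, ∀ b ∈ B, P a → ¬ P b →
        ∃ a ∈ F, ∃ b ∈ F, latAdj a b ∧ P a ∧ ¬ P b := by
      intro B hB hBc a ha b hb hPa hPb
      obtain ⟨a, ha, b, hb, h⟩ := hBc.exists_adj P ha hb hPa hPb
      exact ⟨a, hB ha, b, hB hb, h⟩
    by_cases hPu : P u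
    · by_cases hPv : P v'
      · exact aux _ (latCompIn_subset hy) (connLat_latCompIn hy) v' hvy y
          (mem_latCompIn_self _ _) hPv hPy
      · exact aux U hUF hU u hu v' hv' hPu hPv
    · exact aux _ (latCompIn_subset hx) (connLat_latCompIn hx) x (mem_latCompIn_self _ _) u hux
        hPx hPu

lemma exists_potential {d n : ℕ} (φ : Zd d → Fin d → ZMod 2)
    (hφ : ∀ x i j, i ≠ j → x ∈ box d n → x + unitVec i + unitVec j ∈ box d n →
      φ x i + φ (x + unitVec i) j = φ x j + φ (x + unitVec j) i) (I : Finset (Fin d)) :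
    ∃ g : Zd d → ZMod 2, ∀ i ∈ I, ∀ x ∈ box d n, x + unitVec i ∈ box d n →
      g (x + unitVec i) = g x + φ x i := by
  classical
  induction I using Finset.induction_on with
  | empty => exact ⟨0, by simp⟩
  | @insert j I hj ih =>
    obtain ⟨g, hg⟩ := ih
    refine ⟨fun x => g x + ∑ t ∈ Finset.Ico (-(n : ℤ)) (x j),
      (φ (Function.update x j t) j - g (Function.update x j t + unitVec j)
        + g (Function.update x j t)), ?_⟩
    intro i hi x hx hxi
    rw [Finset.mem_insert] at hi
    by_cases hij : i = j
    · subst hij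
      have hup : ∀ t, Function.update (x + unitVec i) i t = Function.update x i t := by
        intro t; funext k
        by_cases hk : k = i
        · subst hk; simp
        · simp [hk]
      have hxn : -(n : ℤ) ≤ x i := (mem_box.1 hx i).1
      have hI : Finset.Ico (-(n : ℤ)) (x i + 1) = insert (x i) (Finset.Ico (-(n : ℤ)) (x i)) := by
        ext t; simp only [Finset.mem_Ico, Finset.mem_insert]; omega
      simp only [hup, Pi.add_apply, Pi.single_eq_same]
      rw [hI, Finset.sum_insert (by simp)]
      simp only [Function.update_eq_self]
      ring
    · have hiI : i ∈ I := by tauto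
      have hup : ∀ t, Function.update (x + unitVec i) j t = Function.update x j t + unitVec i := by
        intro t; funext k
        by_cases hk : k = j
        · subst hk; simp [Ne.symm hij]
        · simp [hk]
      have hxj : (x + unitVec i) j = x j := by simp [Ne.symm hij]
      simp only [hup, hxj]
      rw [hg i hiI x hx hxi, add_right_comm]
      congr 2
      refine Finset.sum_congr rfl fun t ht => ?_
      rw [Finset.mem_Ico] at ht
      have hb := mem_box.1 hx
      have hbi := mem_box.1 hxi
      set y := Function.update x j t with hy
      have hyj : y j = t := by simp [hy]
      have hyk : ∀ k, k ≠ j → y k = x k := fun k hk => by simp [hy, hk]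
      have e1 : y ∈ box d n := by
        rw [mem_box]; intro k
        by_cases hk : k = j
        · subst hk; have := hb k; omega
        · rw [hyk k hk]; exact hb k
      have e2 : y + unitVec i ∈ box d n := by
        rw [mem_box]; intro k
        by_cases hk : k = j
        · subst hk; have := hb k; simp [Ne.symm hij, hyj]; omega
        · rw [Pi.add_apply, hyk k hk]; exact hbi k
      have e3 : y + unitVec j ∈ box d n := by
        rw [mem_box]; intro k
        by_cases hk : k = j
        · subst hk; have := hb k; simp [hyj]; omega
        · rw [Pi.add_apply, hyk k hk]; have := hb k; simp [hk]; omega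
      have e4 : y + unitVec j + unitVec i ∈ box d n := by
        rw [mem_box]; intro k
        by_cases hk : k = j
        · subst hk; have := hb k; simp [hyj, Ne.symm hij]; omega
        · have := hbi k
          rw [Pi.add_apply] at this
          rw [Pi.add_apply, Pi.add_apply, hyk k hk]; simp only [Pi.single_eq_of_ne hk]; omega
      have h1 := hg i hiI y e1 e2
      have h2 := hg i hiI (y + unitVec j) e3 e4
      have h3 := hφ y j i (Ne.symm hij) e1 e4
      rw [add_right_comm y, h2, h1]
      linear_combination -h3

/-- The lattice edges inside the box; `(x, i)` stands for the edge from `x` to `x + e_i`. -/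
noncomputable def edgesF (d n : ℕ) : Finset (Zd d × Fin d) :=
  (boxF d n ×ˢ Finset.univ).filter fun e => e.1 + unitVec e.2 ∈ boxF d n

lemma mem_edgesF {d n : ℕ} {e : Zd d × Fin d} :
    e ∈ edgesF d n ↔ e.1 ∈ box d n ∧ e.1 + unitVec e.2 ∈ box d n := by
  simp [edgesF, mem_boxF]

open Classical in
/-- The edge boundary of `D` inside the box. -/
noncomputable def edgeBdry (n : ℕ) {d : ℕ} (D : Set (Zd d)) : Finset (Zd d × Fin d) :=
  (edgesF d n).filter fun e => ¬ (e.1 ∈ D ↔ e.1 + unitVec e.2 ∈ D)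

lemma mem_edgeBdry {d n : ℕ} {D : Set (Zd d)} {e : Zd d × Fin d} :
    e ∈ edgeBdry n D ↔ (e.1 ∈ box d n ∧ e.1 + unitVec e.2 ∈ box d n) ∧
      ¬ (e.1 ∈ D ↔ e.1 + unitVec e.2 ∈ D) := by
  simp [edgeBdry, mem_edgesF]

/-- Two edges are close if their base points are at sup-distance at most one. -/
def starAdj {d : ℕ} (u v : Zd d × Fin d) : Prop := ∀ k, |u.1 k - v.1 k| ≤ 1

/-- A finite set of edges is connected for the relation `starAdj`. -/
def StarConn {d : ℕ} (F : Finset (Zd d × Fin d)) : Prop :=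
  ∀ S ⊆ F, S.Nonempty → (∀ u ∈ S, ∀ v ∈ F, starAdj u v → v ∈ S) → S = F

lemma edgeBdry_eq_compl {d n : ℕ} {D : Set (Zd d)} : edgeBdry n (box d n \ D) = edgeBdry n D := by
  ext e
  rw [mem_edgeBdry, mem_edgeBdry]
  simp only [Set.mem_sdiff]
  tauto

lemma eqOn_of_connLat {d : ℕ} {D : Set (Zd d)} (hD : ConnLat D)
    {g : Zd d → ZMod 2}
    (hg : ∀ x i, x ∈ D → x + unitVec i ∈ D → g (x + unitVec i) = g x) {x y : Zd d} (hx : x ∈ D)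
    (hy : y ∈ D) : g y = g x := by
  by_contra hc
  obtain ⟨a, ha, b, hb, hab, h1, h2⟩ := hD.exists_adj (fun z => g z = g x) hx hy rfl hc
  obtain ⟨i, rfl | rfl⟩ := latAdj_iff.1 hab
  · exact h2 ((hg a i ha hb).trans h1)
  · exact h2 ((hg b i hb ha).symm.trans h1)

/-- The edge boundary between two complementary connected subsets of the box is connected. -/
lemma starConn_edgeBdry {d n : ℕ} {D : Set (Zd d)} (hDb : D ⊆ box d n) (hD : ConnLat D)
    (hF : ConnLat (box d n \ D)) : StarConn (edgeBdry n D) := by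
  classical
  intro S hS ⟨s, hs⟩ hcl
  set χ : Zd d → ZMod 2 := fun x => if x ∈ D then 1 else 0 with hχ
  set φ : Zd d → Fin d → ZMod 2 := fun x i => if (x, i) ∈ S then 1 else 0 with hφ
  have hbd : ∀ x i, x ∈ box d n → x + unitVec i ∈ box d n →
      (if (x, i) ∈ edgeBdry n D then (1 : ZMod 2) else 0) = χ x + χ (x + unitVec i) := by
    intro x i hx hxi
    simp only [mem_edgeBdry, hx, hxi, hχ]
    by_cases h1 : x ∈ D <;> by_cases h2 : x + unitVec i ∈ D <;> simp [h1, h2]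
    rfl
  have hclosed : ∀ x i j, i ≠ j → x ∈ box d n → x + unitVec i + unitVec j ∈ box d n →
      φ x i + φ (x + unitVec i) j = φ x j + φ (x + unitVec j) i := by
    intro x i j hij hx hxij
    have hb := mem_box.1 hx
    have hbij := mem_box.1 hxij
    have hxi : x + unitVec i ∈ box d n := by
      rw [mem_box]; intro k
      have := hb k; have := hbij k
      by_cases hk : k = i
      · subst hk; simp [hij] at *; omega
      · simp [hk] at *; omega
    have hxj : x + unitVec j ∈ box d n := by
      rw [mem_box]; intro k
      have := hb k; have := hbij k
      by_cases hk : k = j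
      · subst hk; simp [Ne.symm hij] at *; omega
      · simp [hk] at *; omega
    have hxji : x + unitVec j + unitVec i ∈ box d n := by rwa [add_right_comm]
    set near : Zd d × Fin d → Prop := fun u => ∀ k, x k ≤ u.1 k ∧ u.1 k ≤ x k + 1 with hnear
    have hstar : ∀ u v, near u → near v → starAdj u v := by
      intro u v hu hv k
      have := hu k; have := hv k
      rw [abs_le]; omega
    have hn0 : ∀ l, near (x, l) := fun l k => by simp
    have hn1 : ∀ m l, near (x + unitVec m, l) := fun m l k => by
      by_cases hk : k = m
      · subst hk; simp
      · simp [hk]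
    by_cases hex : ∃ u ∈ S, near u
    · obtain ⟨u, hu, hun⟩ := hex
      have hiff : ∀ v, near v → (v ∈ S ↔ v ∈ edgeBdry n D) := fun v hv =>
        ⟨fun h => hS h, fun h => hcl u hu v h (hstar u v hun hv)⟩
      simp only [hφ, hiff _ (hn0 _), hiff _ (hn1 _ _)]
      rw [hbd x i hx hxi, hbd _ j hxi hxij, hbd x j hx hxj, hbd _ i hxj hxji, add_right_comm x]
      have h2 : (2 : ZMod 2) = 0 := rfl
      linear_combination (χ (x + unitVec i) - χ (x + unitVec j)) * h2
    · push Not at hex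
      have hz : ∀ v, near v → v ∉ S := fun v hv h => hex v h hv
      simp only [hφ, hz _ (hn0 _), hz _ (hn1 _ _)]
  obtain ⟨g, hg⟩ := exists_potential φ hclosed Finset.univ
  have hg' : ∀ x i, x ∈ box d n → x + unitVec i ∈ box d n → (x, i) ∉ edgeBdry n D →
      g (x + unitVec i) = g x := by
    intro x i h1 h2 h3
    rw [hg i (Finset.mem_univ i) x h1 h2]
    simp only [hφ, if_neg fun h => h3 (hS h), add_zero]
  have cD : ∀ x ∈ D, ∀ y ∈ D, g y = g x := fun x hx y hy =>
    eqOn_of_connLat hD (fun x i h1 h2 => hg' x i (hDb h1) (hDb h2)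
      (by rw [mem_edgeBdry]; simp [h1, h2])) hx hy
  have cF : ∀ x ∈ box d n \ D, ∀ y ∈ box d n \ D, g y = g x := fun x hx y hy =>
    eqOn_of_connLat hF (fun x i h1 h2 => hg' x i h1.1 h2.1
      (by rw [mem_edgeBdry]; simp [h1.2, h2.2])) hx hy
  have split : ∀ u ∈ edgeBdry n D, ∃ a ∈ D, ∃ b ∈ box d n \ D,
      g a - g b = g (u.1 + unitVec u.2) - g u.1 := by
    intro u hu
    rw [mem_edgeBdry] at hu
    by_cases h1 : u.1 ∈ D
    · have h2 : u.1 + unitVec u.2 ∉ D := by tauto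
      refine ⟨_, h1, _, ⟨hu.1.2, h2⟩, ?_⟩
      have h2 : (2 : ZMod 2) = 0 := rfl
      linear_combination (g u.1 - g (u.1 + unitVec u.2)) * h2
    · have h2 : u.1 + unitVec u.2 ∈ D := by tauto
      exact ⟨_, h2, _, ⟨hu.1.1, h1⟩, rfl⟩
  refine Finset.Subset.antisymm hS fun u hu => ?_
  obtain ⟨a, ha, b, hb, hab⟩ := split s (hS hs)
  obtain ⟨a', ha', b', hb', hab'⟩ := split u hu
  rw [cD a ha a' ha', cF b hb b' hb', hab] at hab'
  have m1 := mem_edgeBdry.1 (hS hs)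
  have m2 := mem_edgeBdry.1 hu
  rw [hg s.2 (Finset.mem_univ _) s.1 m1.1.1 m1.1.2,
    hg u.2 (Finset.mem_univ _) u.1 m2.1.1 m2.1.2] at hab'
  by_contra hc
  simp [hφ, hs, hc] at hab'

/-- A weak form of the Loomis-Whitney inequality: if each axis-parallel line through `S`
meets `W`, then `|S| ≤ |W| ^ (d / (d - 1))`. -/
lemma card_le_rpow_of_lines {d : ℕ} (hd : 2 ≤ d) (S W : Finset (Zd d))
    (h : ∀ x ∈ S, ∀ i, ∃ t, Function.update x i t ∈ W) :
    (S.card : ℝ) ≤ (W.card : ℝ) ^ ((d : ℝ) / (d - 1)) := by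
  classical
  have hd' : (1 : ℝ) < d := by exact_mod_cast hd
  have hp : ((Fintype.card (Fin d) : ℕ) : ℝ).HolderConjugate ((d : ℝ) / (d - 1)) := by
    rw [Fintype.card_fin]
    exact Real.HolderConjugate.conjExponent hd'
  have hmeas : ∀ T : Finset (Zd d), Measure.pi (fun _ : Fin d => (Measure.count : Measure ℤ)) T
      = T.card := by
    intro T
    rw [← sum_measure_singleton]
    simp
  have hcount : ∀ T : Finset (Zd d), ∫⁻ x, (T : Set (Zd d)).indicator 1 x
      ∂Measure.pi (fun _ : Fin d => (Measure.count : Measure ℤ)) = T.card := by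
    intro T
    rw [lintegral_indicator_one T.measurableSet, hmeas]
  have key := lintegral_prod_lintegral_pow_le (fun _ : Fin d => (Measure.count : Measure ℤ)) hp
    (f := (W : Set (Zd d)).indicator 1) (measurable_one.indicator W.measurableSet)
  rw [hcount] at key
  have hle : (S.card : ℝ≥0∞) ≤ (W.card : ℝ≥0∞) ^ ((d : ℝ) / (d - 1)) := by
    rw [← hcount S]
    refine le_trans (lintegral_mono fun x => ?_) key
    by_cases hx : x ∈ S
    · simp only [Finset.mem_coe, hx, Set.indicator_of_mem, Pi.one_apply]
      refine Finset.one_le_prod' fun i _ => ?_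
      refine ENNReal.one_le_rpow ?_ ?_
      · obtain ⟨t, ht⟩ := h x hx i
        rw [lintegral_count]
        refine le_trans ?_ (ENNReal.le_tsum t)
        simp [ht]
      · simp only [Fintype.card_fin]
        have : (0 : ℝ) < d - 1 := by linarith
        positivity
    · simp [hx]
  have hnn : (0 : ℝ) ≤ (d : ℝ) / (d - 1) := div_nonneg (by linarith) (by linarith)
  have := ENNReal.toReal_mono (ENNReal.rpow_ne_top_of_nonneg hnn (ENNReal.natCast_ne_top _)) hle
  rwa [← ENNReal.toReal_rpow, ENNReal.toReal_natCast, ENNReal.toReal_natCast] at this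

lemma exists_edge_of_latAdj {d n : ℕ} {D : Set (Zd d)} {w w' : Zd d} (h : latAdj w w')
    (hw : w ∈ box d n) (hw' : w' ∈ box d n) (hD : w ∈ D) (hD' : w' ∉ D) :
    ∃ e ∈ edgeBdry n D, (e.1 = w ∧ e.1 + unitVec e.2 = w') ∨
      (e.1 = w' ∧ e.1 + unitVec e.2 = w) := by
  obtain ⟨i, rfl | rfl⟩ := latAdj_iff.1 h
  · exact ⟨(w, i), by rw [mem_edgeBdry]; simp [*], by simp⟩
  · exact ⟨(w', i), by rw [mem_edgeBdry]; simp [*], by simp⟩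

/-- Isoperimetric inequality for sets that contain no full line of the box. -/
lemma card_le_rpow_edgeBdry {d n : ℕ} (hd : 2 ≤ d) {S : Finset (Zd d)}
    (hS : (S : Set (Zd d)) ⊆ box d n)
    (hline : ∀ x ∈ S, ∀ i, ∃ t : ℤ, -(n : ℤ) ≤ t ∧ t ≤ n ∧ Function.update x i t ∉ S) :
    (S.card : ℝ) ≤ ((edgeBdry n (S : Set (Zd d))).card : ℝ) ^ ((d : ℝ) / (d - 1)) := by
  classical
  have hd' : (1 : ℝ) < d := by exact_mod_cast hd
  set W := (edgeBdry n (S : Set (Zd d))).image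
    (fun e => if e.1 ∈ S then e.1 else e.1 + unitVec e.2) with hW
  refine (card_le_rpow_of_lines hd S W fun x hx i => ?_).trans ?_
  · obtain ⟨t, ht1, ht2, ht⟩ := hline x hx i
    have hxb := hS hx
    have htb : Function.update x i t ∈ box d n := by
      rw [mem_box] at *; intro k
      by_cases hk : k = i
      · subst hk; simp [ht1, ht2]
      · simpa [hk] using hxb k
    obtain ⟨w, w', h1, h2, h3, h4⟩ := exists_crossing (· ∈ S) hx ht
    obtain ⟨e, he, hew⟩ := exists_edge_of_latAdj (D := (S : Set (Zd d))) h1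
      (mem_box_of_between hxb htb fun k => (h4 k).1)
      (mem_box_of_between hxb htb fun k => (h4 k).2) h2 h3
    refine ⟨w i, ?_⟩
    have hwx : Function.update x i (w i) = w := by
      funext k
      by_cases hk : k = i
      · subst hk; simp
      · have := (h4 k).1
        simp [hk] at this
        simp [hk]; omega
    rw [hwx, hW, Finset.mem_image]
    refine ⟨e, he, ?_⟩
    rcases hew with ⟨h5, h6⟩ | ⟨h5, h6⟩
    · simp [h5, h2]
    · rw [if_neg (by rw [h5]; exact h3), h6]
  · exact Real.rpow_le_rpow (by positivity) (by exact_mod_cast Finset.card_image_le)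
      (div_nonneg (by linarith) (by linarith))

/-- If `D` contains a full line of the box, its complement is small compared to its boundary. -/
lemma compl_card_mul_le_of_line {d n : ℕ} {D : Set (Zd d)} {x : Zd d} (hx : x ∈ box d n)
    {i : Fin d} (hline : ∀ t : ℤ, -(n : ℤ) ≤ t → t ≤ n → Function.update x i t ∈ D) :
    (box d n \ D).ncard * (2 * n + 1) ≤ (edgeBdry n D).card * (2 * n + 1) ^ d := by
  classical
  have hup : ∀ t : ℤ, -(n : ℤ) ≤ t → t ≤ n → ∀ z ∈ box d n, Function.update z i t ∈ box d n := by
    intro t h1 h2 z hz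
    rw [mem_box] at *; intro k
    by_cases hk : k = i
    · subst hk; simp [h1, h2]
    · simpa [hk] using hz k
  have hedge : ∀ y ∈ box d n \ D, ∃ e ∈ edgeBdry n D, e.1 i = y i := by
    rintro y ⟨hyb, hyD⟩
    have hyi := mem_box.1 hyb i
    have hzb := hup (y i) hyi.1 hyi.2 x hx
    obtain ⟨w, w', h1, h2, h3, h4⟩ :=
      exists_crossing (· ∈ D) (hline (y i) hyi.1 hyi.2) hyD
    obtain ⟨e, he, hew⟩ := exists_edge_of_latAdj (D := D) h1
      (mem_box_of_between hzb hyb fun k => (h4 k).1)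
      (mem_box_of_between hzb hyb fun k => (h4 k).2) h2 h3
    have := h4 i
    simp at this
    refine ⟨e, he, ?_⟩
    rcases hew with ⟨h5, _⟩ | ⟨h5, _⟩ <;> rw [h5] <;> omega
  have : Nonempty (Zd d × Fin d) := ⟨(0, i)⟩
  choose! E hE hEi using hedge
  set F := (boxF d n).filter (· ∉ D) with hF
  have hFc : (F : Set (Zd d)) = box d n \ D := by
    ext z; simp [hF, mem_boxF]
  have hI : (Finset.Icc (-(n : ℤ)) n).card = 2 * n + 1 := by
    rw [Int.card_Icc]; omega
  rw [← hFc, Set.ncard_coe_finset, ← card_boxF, ← hI, ← Finset.card_product, ← Finset.card_product]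
  refine Finset.card_le_card_of_injOn (fun q => (E q.1, Function.update q.1 i q.2)) ?_ ?_
  · rintro ⟨y, t⟩ hq
    simp only [Finset.coe_product, Set.mem_prod, Finset.mem_coe, Finset.mem_Icc] at hq ⊢
    have hy : y ∈ box d n \ D := hFc ▸ hq.1
    exact ⟨hE y hy, mem_boxF.2 (hup t hq.2.1 hq.2.2 y hy.1)⟩
  · rintro ⟨y, t⟩ hq ⟨y', t'⟩ hq' heq
    simp only [Finset.coe_product, Set.mem_prod, Finset.mem_coe, Prod.mk.injEq] at hq hq' heq
    have hy : y ∈ box d n \ D := hFc ▸ hq.1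
    have hy' : y' ∈ box d n \ D := hFc ▸ hq'.1
    have h1 : y i = y' i := by rw [← hEi y hy, ← hEi y' hy', heq.1]
    have h2 : t = t' := by simpa using congrFun heq.2 i
    have h3 : y = y' := by
      funext k
      by_cases hk : k = i
      · subst hk; exact h1
      · simpa [hk] using congrFun heq.2 k
    simp [h2, h3]

lemma ncard_le_rpow_or_line {d n : ℕ} (hd : 2 ≤ d) {D : Set (Zd d)} (hD : D ⊆ box d n) :
    (D.ncard : ℝ) ≤ ((edgeBdry n D).card : ℝ) ^ ((d : ℝ) / (d - 1)) ∨
      (box d n \ D).ncard * (2 * n + 1) ≤ (edgeBdry n D).card * (2 * n + 1) ^ d := by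
  classical
  by_cases h : ∃ x ∈ D, ∃ i, ∀ t : ℤ, -(n : ℤ) ≤ t → t ≤ n → Function.update x i t ∈ D
  · obtain ⟨x, hx, i, h⟩ := h
    exact Or.inr (compl_card_mul_le_of_line (hD hx) h)
  · push Not at h
    left
    have hfin : D.Finite := (box_finite d n).subset hD
    have := card_le_rpow_edgeBdry (n := n) hd (S := hfin.toFinset) (by simpa using hD)
      (by simpa using h)
    rwa [← Set.ncard_eq_toFinset_card D hfin, hfin.coe_toFinset] at this

/-- A subset of the box with small boundary is small or has a small complement. -/
lemma ncard_le_or_compl_ncard_le {d n : ℕ} (hd : 2 ≤ d) {D : Set (Zd d)} (hD : D ⊆ box d n)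
    (hb : 2 * (edgeBdry n D).card < 2 * n + 1) :
    (D.ncard : ℝ) ≤ ((edgeBdry n D).card : ℝ) ^ ((d : ℝ) / (d - 1)) ∨
      ((box d n \ D).ncard : ℝ) ≤ ((edgeBdry n D).card : ℝ) ^ ((d : ℝ) / (d - 1)) := by
  rcases ncard_le_rpow_or_line hd hD with h | h1
  · exact Or.inl h
  rcases ncard_le_rpow_or_line hd (D := box d n \ D) Set.sdiff_subset with h | h2
  · exact Or.inr (by rwa [edgeBdry_eq_compl] at h)
  rw [edgeBdry_eq_compl, sdiff_sdiff_right_self, inf_eq_right.2 hD] at h2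
  have hsum : (box d n \ D).ncard + D.ncard = (2 * n + 1) ^ d := by
    rw [Set.ncard_sdiff_add_ncard_of_subset hD (box_finite d n), ← coe_boxF, Set.ncard_coe_finset,
      card_boxF]
  have hpos : 0 < (2 * n + 1) ^ d := by positivity
  exfalso
  nlinarith

/-- The edges close to `u`. -/
noncomputable def starNbrs {d : ℕ} (u : Zd d × Fin d) : Finset (Zd d × Fin d) :=
  (Fintype.piFinset fun k => Finset.Icc (u.1 k - 1) (u.1 k + 1)) ×ˢ Finset.univ

lemma mem_starNbrs {d : ℕ} {u v : Zd d × Fin d} : v ∈ starNbrs u ↔ starAdj u v := by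
  simp only [starNbrs, Finset.mem_product, Fintype.mem_piFinset, Finset.mem_Icc, Finset.mem_univ,
    and_true, starAdj, abs_le]
  refine forall_congr' fun k => ?_
  omega

lemma card_starNbrs {d : ℕ} (u : Zd d × Fin d) : (starNbrs u).card = 3 ^ d * d := by
  have : ∀ k, (Finset.Icc (u.1 k - 1) (u.1 k + 1)).card = 3 := fun k => by
    rw [Int.card_Icc]; omega
  simp [starNbrs, Finset.card_product, Fintype.card_piFinset, this]

lemma starAdj_symm {d : ℕ} {u v : Zd d × Fin d} (h : starAdj u v) : starAdj v u := fun k => by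
  rw [abs_sub_comm]; exact h k

open Classical in
/-- The ranges of the walks with `k` steps starting at `e`. -/
noncomputable def walkRanges {d : ℕ} : ℕ → Zd d × Fin d → Finset (Finset (Zd d × Fin d))
  | 0, e => {{e}}
  | k + 1, e => (starNbrs e).biUnion fun e' => (walkRanges k e').image (insert e)

lemma card_walkRanges_le {d : ℕ} (k : ℕ) (e : Zd d × Fin d) :
    (walkRanges k e).card ≤ (3 ^ d * d) ^ k := by
  classical
  induction k generalizing e with
  | zero => simp [walkRanges]
  | succ k ih =>
    rw [walkRanges, pow_succ', ← card_starNbrs e]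
    refine Finset.card_biUnion_le_card_mul _ _ _ fun e' _ => ?_
    rw [card_starNbrs]
    exact Finset.card_image_le.trans (ih e')

lemma mem_walkRanges_succ {d : ℕ} [DecidableEq (Zd d × Fin d)] {k : ℕ} {e : Zd d × Fin d}
    {S : Finset (Zd d × Fin d)} :
    S ∈ walkRanges (k + 1) e ↔ ∃ e', starAdj e e' ∧ ∃ T ∈ walkRanges k e', insert e T = S := by
  rw [walkRanges]
  simp only [Finset.mem_biUnion, mem_starNbrs, Finset.mem_image]
  refine exists_congr fun e' => and_congr_right fun _ => exists_congr fun T =>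
    and_congr_right fun _ => ?_
  simp [Finset.ext_iff]

lemma mem_of_mem_walkRanges {d : ℕ} {k : ℕ} {e : Zd d × Fin d} {S : Finset (Zd d × Fin d)}
    (hS : S ∈ walkRanges k e) : e ∈ S := by
  classical
  cases k with
  | zero =>
    simp only [walkRanges, Finset.mem_singleton] at hS
    simp [hS]
  | succ k =>
    obtain ⟨e', -, T, -, rfl⟩ := mem_walkRanges_succ.1 hS
    simp

lemma insert_mem_walkRanges {d : ℕ} [DecidableEq (Zd d × Fin d)] {k : ℕ} {e u v : Zd d × Fin d}
    {S : Finset (Zd d × Fin d)} (hS : S ∈ walkRanges k e) (hu : u ∈ S) (huv : starAdj u v) :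
    insert v S ∈ walkRanges (k + 2) e := by
  have detour : ∀ k (e : Zd d × Fin d) S, S ∈ walkRanges k e → starAdj e v →
      insert v S ∈ walkRanges (k + 2) e := by
    intro k e S hS hev
    refine mem_walkRanges_succ.2 ⟨v, hev, insert v S,
      mem_walkRanges_succ.2 ⟨e, starAdj_symm hev, S, hS, rfl⟩, ?_⟩
    exact Finset.insert_eq_of_mem (Finset.mem_insert_of_mem (mem_of_mem_walkRanges hS))
  induction k generalizing e S with
  | zero =>
    have hS' := hS
    simp only [walkRanges, Finset.mem_singleton] at hS'
    subst hS'
    rw [Finset.mem_singleton] at hu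
    subst hu
    exact detour 0 u _ hS huv
  | succ k ih =>
    by_cases hue : u = e
    · subst hue
      exact detour _ u S hS huv
    · obtain ⟨e', he', T, hT, rfl⟩ := mem_walkRanges_succ.1 hS
      have huT : u ∈ T := (Finset.mem_insert.1 hu).resolve_left hue
      exact mem_walkRanges_succ.2 ⟨e', he', insert v T, ih hT huT, Finset.insert_comm _ _ _⟩

/-- A connected set of edges is the range of a walk of twice its size. -/
lemma StarConn.mem_walkRanges {d : ℕ} {F : Finset (Zd d × Fin d)} (hF : StarConn F)
    {e : Zd d × Fin d} (he : e ∈ F) : F ∈ walkRanges (2 * (F.card - 1)) e := by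
  classical
  have grow : ∀ j, j < F.card → ∃ S ⊆ F, S.card = j + 1 ∧ S ∈ walkRanges (2 * j) e := by
    intro j
    induction j with
    | zero => exact fun _ => ⟨{e}, by simpa using he, by simp, by simp [walkRanges]⟩
    | succ j ih =>
      intro hj
      obtain ⟨S, hSF, hSc, hS⟩ := ih (by omega)
      have : ∃ u ∈ S, ∃ v ∈ F, starAdj u v ∧ v ∉ S := by
        by_contra! hc
        have := hF S hSF ⟨e, mem_of_mem_walkRanges hS⟩ hc
        subst this
        omega
      obtain ⟨u, hu, v, hv, huv, hvS⟩ := this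
      exact ⟨insert v S, Finset.insert_subset hv hSF, by rw [Finset.card_insert_of_notMem hvS, hSc],
        insert_mem_walkRanges hS hu huv⟩
  have hpos : 0 < F.card := Finset.card_pos.2 ⟨e, he⟩
  obtain ⟨S, hSF, hSc, hS⟩ := grow (F.card - 1) (by omega)
  rwa [Finset.eq_of_subset_of_card_le hSF (by omega)] at hS

/-- The unordered pair of endpoints of an edge. -/
def toSym {d : ℕ} (e : Zd d × Fin d) : Sym2 (Zd d) := s(e.1, e.1 + unitVec e.2)

lemma toSym_injective {d : ℕ} : Function.Injective (toSym (d := d)) := by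
  rintro ⟨x, i⟩ ⟨y, j⟩ h
  simp only [toSym, Sym2.eq_iff] at h
  rcases h with ⟨rfl, h⟩ | ⟨h1, h2⟩
  · have hij : unitVec i = (unitVec j : Zd d) := add_left_cancel h
    have := congrFun hij i
    by_cases hc : i = j
    · rw [hc]
    · simp [hc] at this
  · exfalso
    have h3 := congrFun h1 i
    have h4 := congrFun h2 i
    by_cases hc : i = j
    · subst hc; simp at h3 h4; omega
    · simp [hc] at h3 h4; omega

open Classical in
/-- At scale `n`, connected sets of at least `n ^ ε` edges are at least half open. -/
def Good {d : ℕ} (ε : ℝ) (ω : Config d) (n : ℕ) : Prop :=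
  ∀ F ⊆ edgesF d n, StarConn F → (n : ℝ) ^ ε ≤ F.card →
    F.card ≤ 2 * (F.filter fun e => ω (toSym e) = true).card

lemma IsBernoulli.measure_closed {d : ℕ} {p : ℝ} {Q : Measure (Config d)} (hQ : IsBernoulli p Q)
    (G : Finset (Zd d × Fin d)) :
    Q {ω | ∀ e ∈ G, ω (toSym e) = false} = ENNReal.ofReal (1 - p) ^ G.card := by
  classical
  have := hQ.2 (G.image toSym) fun _ => false
  simp only [Finset.forall_mem_image, Finset.prod_const, Bool.false_eq_true, if_false] at this
  rw [this, Finset.card_image_of_injective _ toSym_injective]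

lemma measure_half_closed_le {d : ℕ} {p η : ℝ} (hη0 : 0 ≤ η) (hη1 : η ≤ 1)
    (hp : 1 - p ≤ η ^ 2) {Q : Measure (Config d)} (hQ : IsBernoulli p Q)
    (F : Finset (Zd d × Fin d)) :
    Q {ω | ∃ G ⊆ F, F.card ≤ 2 * G.card ∧ ∀ e ∈ G, ω (toSym e) = false} ≤
      ENNReal.ofReal ((2 * η) ^ F.card) := by
  classical
  have hsub : {ω : Config d | ∃ G ⊆ F, F.card ≤ 2 * G.card ∧ ∀ e ∈ G, ω (toSym e) = false} ⊆
      ⋃ G ∈ F.powerset.filter (fun G => F.card ≤ 2 * G.card),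
        {ω | ∀ e ∈ G, ω (toSym e) = false} := by
    rintro ω ⟨G, hG, hc, h⟩
    simp only [Set.mem_iUnion, Finset.mem_filter, Finset.mem_powerset]
    exact ⟨G, ⟨hG, hc⟩, h⟩
  refine (measure_mono hsub).trans ((measure_biUnion_finset_le _ _).trans ?_)
  have hterm : ∀ G ∈ F.powerset.filter (fun G => F.card ≤ 2 * G.card),
      Q {ω | ∀ e ∈ G, ω (toSym e) = false} ≤ ENNReal.ofReal (η ^ F.card) := by
    intro G hG
    rw [hQ.measure_closed]
    calc ENNReal.ofReal (1 - p) ^ G.card ≤ ENNReal.ofReal (η ^ 2) ^ G.card := by gcongr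
      _ = ENNReal.ofReal (η ^ (2 * G.card)) := by
        rw [← ENNReal.ofReal_pow (by positivity), pow_mul]
      _ ≤ _ := ENNReal.ofReal_le_ofReal
        (pow_le_pow_of_le_one hη0 hη1 (Finset.mem_filter.1 hG).2)
  refine (Finset.sum_le_card_nsmul _ _ _ hterm).trans ?_
  have hc : (F.powerset.filter (fun G => F.card ≤ 2 * G.card)).card ≤ 2 ^ F.card :=
    (Finset.card_filter_le _ _).trans (Finset.card_powerset F).le
  rw [nsmul_eq_mul, mul_pow, ENNReal.ofReal_mul (by positivity)]
  gcongr
  rw [ENNReal.ofReal_pow (by norm_num)]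
  norm_num
  exact_mod_cast hc

lemma measure_animal_le {d : ℕ} (hd : 1 ≤ d) {p η : ℝ} (hη : η = 1 / (4 * (3 ^ d * d : ℝ) ^ 2))
    (hp : 1 - p ≤ η ^ 2) {Q : Measure (Config d)} (hQ : IsBernoulli p Q) (e : Zd d × Fin d)
    (m : ℕ) :
    Q {ω | ∃ F, StarConn F ∧ e ∈ F ∧ F.card = m ∧
      ∃ G ⊆ F, F.card ≤ 2 * G.card ∧ ∀ e ∈ G, ω (toSym e) = false} ≤
      ENNReal.ofReal ((1 / 2) ^ m) := by
  classical
  set Δ : ℕ := 3 ^ d * d with hΔ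
  have hΔ1 : 1 ≤ Δ := Nat.one_le_iff_ne_zero.2 (by positivity)
  have hΔ1' : (1 : ℝ) ≤ Δ := by exact_mod_cast hΔ1
  have hηΔ : η = 1 / (4 * (Δ : ℝ) ^ 2) := by rw [hη, hΔ]; push_cast; rfl
  have hη0 : 0 ≤ η := by rw [hηΔ]; positivity
  have hη1 : η ≤ 1 := by
    rw [hηΔ, div_le_one (by positivity)]
    nlinarith
  have hsub : {ω : Config d | ∃ F, StarConn F ∧ e ∈ F ∧ F.card = m ∧
      ∃ G ⊆ F, F.card ≤ 2 * G.card ∧ ∀ e ∈ G, ω (toSym e) = false} ⊆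
      ⋃ F ∈ (walkRanges (2 * (m - 1)) e).filter (fun F => F.card = m),
        {ω | ∃ G ⊆ F, F.card ≤ 2 * G.card ∧ ∀ e ∈ G, ω (toSym e) = false} := by
    rintro ω ⟨F, hF, he, hc, h⟩
    simp only [Set.mem_iUnion, Finset.mem_filter]
    exact ⟨F, ⟨hc ▸ hF.mem_walkRanges he, hc⟩, h⟩
  refine (measure_mono hsub).trans ((measure_biUnion_finset_le _ _).trans ?_)
  have hterm : ∀ F ∈ (walkRanges (2 * (m - 1)) e).filter (fun F => F.card = m),
      Q {ω | ∃ G ⊆ F, F.card ≤ 2 * G.card ∧ ∀ e ∈ G, ω (toSym e) = false} ≤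
        ENNReal.ofReal ((2 * η) ^ m) := by
    intro F hF
    exact (measure_half_closed_le hη0 hη1 hp hQ F).trans (by rw [(Finset.mem_filter.1 hF).2])
  refine (Finset.sum_le_card_nsmul _ _ _ hterm).trans ?_
  have hc : ((walkRanges (2 * (m - 1)) e).filter (fun F => F.card = m)).card ≤ Δ ^ (2 * m) :=
    (Finset.card_filter_le _ _).trans ((card_walkRanges_le _ _).trans
      (Nat.pow_le_pow_right hΔ1 (by omega)))
  rw [nsmul_eq_mul]
  calc (((walkRanges (2 * (m - 1)) e).filter (fun F => F.card = m)).card : ℝ≥0∞) *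
        ENNReal.ofReal ((2 * η) ^ m)
      ≤ ((Δ ^ (2 * m) : ℕ) : ℝ≥0∞) * ENNReal.ofReal ((2 * η) ^ m) := by gcongr
    _ = ENNReal.ofReal ((1 / 2) ^ m) := by
      rw [← ENNReal.ofReal_natCast, ← ENNReal.ofReal_mul (by positivity)]
      congr 1
      push_cast
      rw [pow_mul, ← mul_pow, hηΔ]
      congr 1
      field_simp
      norm_num

lemma card_edgesF_le (d n : ℕ) : (edgesF d n).card ≤ (2 * n + 1) ^ d * d := by
  refine (Finset.card_filter_le _ _).trans ?_
  rw [Finset.card_product, card_boxF]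
  simp

lemma measure_not_good_le {d : ℕ} (hd : 1 ≤ d) {p η ε : ℝ}
    (hη : η = 1 / (4 * (3 ^ d * d : ℝ) ^ 2))
    (hp : 1 - p ≤ η ^ 2) {Q : Measure (Config d)} (hQ : IsBernoulli p Q) (n : ℕ) :
    Q {ω | ¬ Good ε ω n} ≤
      ENNReal.ofReal (((2 * n + 1) ^ d * d + 1) ^ 2 * (1 / 2 : ℝ) ^ ((n : ℝ) ^ ε)) := by
  classical
  set R := (Finset.range ((edgesF d n).card + 1)).filter
    (fun m : ℕ => (n : ℝ) ^ ε ≤ (m : ℝ)) with hR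
  have hsub : {ω : Config d | ¬ Good ε ω n} ⊆ ⋃ e ∈ edgesF d n, ⋃ m ∈ R,
      {ω | ∃ F, StarConn F ∧ e ∈ F ∧ F.card = m ∧
        ∃ G ⊆ F, F.card ≤ 2 * G.card ∧ ∀ e ∈ G, ω (toSym e) = false} := by
    intro ω hω
    simp only [Set.mem_ofPred_eq, Good] at hω
    push Not at hω
    obtain ⟨F, hFE, hF, hnF, hlt⟩ := hω
    have hne : F.Nonempty := Finset.card_pos.1 (by omega)
    obtain ⟨e, he⟩ := hne
    simp only [Set.mem_iUnion]
    refine ⟨e, hFE he, F.card, ?_, F, hF, he, rfl, F.filter fun e => ¬ ω (toSym e) = true,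
      Finset.filter_subset _ _, ?_, ?_⟩
    · rw [hR, Finset.mem_filter, Finset.mem_range]
      exact ⟨Nat.lt_succ_of_le (Finset.card_le_card hFE), hnF⟩
    · have := Finset.card_filter_add_card_filter_not (s := F) (fun e => ω (toSym e) = true)
      omega
    · intro e he
      simpa using (Finset.mem_filter.1 he).2
  refine (measure_mono hsub).trans ((measure_biUnion_finset_le _ _).trans ?_)
  have hcE : ((edgesF d n).card : ℝ) ≤ (2 * n + 1) ^ d * d := by
    exact_mod_cast card_edgesF_le d n
  set q : ℝ := (1 / 2 : ℝ) ^ ((n : ℝ) ^ ε) with hq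
  have hq0 : 0 ≤ q := by positivity
  have h1 : ∀ e ∈ edgesF d n, Q (⋃ m ∈ R, {ω | ∃ F, StarConn F ∧ e ∈ F ∧ F.card = m ∧
        ∃ G ⊆ F, F.card ≤ 2 * G.card ∧ ∀ e ∈ G, ω (toSym e) = false}) ≤
        ENNReal.ofReal (((2 * n + 1) ^ d * d + 1) * q) := by
    intro e _
    refine (measure_biUnion_finset_le _ _).trans ?_
    have hterm : ∀ m ∈ R, Q {ω | ∃ F, StarConn F ∧ e ∈ F ∧ F.card = m ∧
        ∃ G ⊆ F, F.card ≤ 2 * G.card ∧ ∀ e ∈ G, ω (toSym e) = false} ≤ ENNReal.ofReal q := by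
      intro m hm
      refine (measure_animal_le hd hη hp hQ e m).trans (ENNReal.ofReal_le_ofReal ?_)
      rw [hq, ← Real.rpow_natCast]
      exact Real.rpow_le_rpow_of_exponent_ge (by norm_num) (by norm_num) (Finset.mem_filter.1 hm).2
    refine (Finset.sum_le_card_nsmul _ _ _ hterm).trans ?_
    rw [nsmul_eq_mul, ← ENNReal.ofReal_natCast, ← ENNReal.ofReal_mul (by positivity)]
    refine ENNReal.ofReal_le_ofReal (mul_le_mul_of_nonneg_right ?_ hq0)
    have : (R.card : ℝ) ≤ (edgesF d n).card + 1 := by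
      have := Finset.card_filter_le (Finset.range ((edgesF d n).card + 1))
        (fun m : ℕ => (n : ℝ) ^ ε ≤ (m : ℝ))
      rw [Finset.card_range] at this
      exact_mod_cast this
    linarith
  refine (Finset.sum_le_card_nsmul _ _ _ h1).trans ?_
  rw [nsmul_eq_mul, ← ENNReal.ofReal_natCast, ← ENNReal.ofReal_mul (by positivity)]
  refine ENNReal.ofReal_le_ofReal ?_
  rw [sq, mul_assoc]
  refine mul_le_mul_of_nonneg_right (by linarith) (by positivity)

lemma summable_poly_mul_half_rpow (d : ℕ) {ε : ℝ} (hε : 0 < ε) :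
    Summable fun n : ℕ => ((2 * n + 1 : ℝ) ^ d * d + 1) ^ 2 * (1 / 2 : ℝ) ^ ((n : ℝ) ^ ε) := by
  have hlim := (tendsto_rpow_mul_exp_neg_mul_atTop_nhds_zero ((2 * d + 2 : ℕ) / ε) (Real.log 2)
    (Real.log_pos (by norm_num))).comp ((tendsto_rpow_atTop hε).comp tendsto_natCast_atTop_atTop)
  have hev := hlim.eventually (gt_mem_nhds (zero_lt_one' ℝ))
  have hsum : Summable fun n : ℕ => ((3 ^ d * d + 1 : ℝ) ^ 2) * (1 / (n : ℝ) ^ 2) :=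
    (Real.summable_one_div_nat_pow.2 (by norm_num)).mul_left _
  refine summable_of_isBigO_nat hsum (Asymptotics.IsBigO.of_bound 1 ?_)
  filter_upwards [hev, Filter.eventually_ge_atTop 1] with n hn hn1
  have hn1' : (1 : ℝ) ≤ n := by exact_mod_cast hn1
  have hn0 : (0 : ℝ) < n := by linarith
  rw [one_mul, Real.norm_of_nonneg (by positivity), Real.norm_of_nonneg (by positivity)]
  have hq : (1 / 2 : ℝ) ^ ((n : ℝ) ^ ε) = Real.exp (-Real.log 2 * (n : ℝ) ^ ε) := by
    rw [Real.rpow_def_of_pos (by norm_num)]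
    congr 1
    rw [one_div, Real.log_inv]
  simp only [Function.comp_apply] at hn
  rw [← hq, ← Real.rpow_mul hn0.le, mul_div_cancel₀ _ hε.ne', Real.rpow_natCast] at hn
  have hbase : (2 * n + 1 : ℝ) ^ d * d + 1 ≤ (3 ^ d * d + 1) * (n : ℝ) ^ d := by
    have h1 : (2 * n + 1 : ℝ) ^ d ≤ 3 ^ d * (n : ℝ) ^ d := by
      rw [← mul_pow]; gcongr; linarith
    have h2 : (1 : ℝ) ≤ (n : ℝ) ^ d := one_le_pow₀ hn1'
    nlinarith [mul_le_mul_of_nonneg_right h1 (Nat.cast_nonneg d : (0 : ℝ) ≤ d)]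
  have hq2 : (1 / 2 : ℝ) ^ ((n : ℝ) ^ ε) ≤ 1 / (n : ℝ) ^ (2 * d + 2) := by
    rw [le_div_iff₀ (by positivity)]
    linarith
  calc _ ≤ ((3 ^ d * d + 1) * (n : ℝ) ^ d) ^ 2 * (1 / (n : ℝ) ^ (2 * d + 2)) := by gcongr
    _ = _ := by field_simp; ring

lemma ae_eventually_good {d : ℕ} (hd : 1 ≤ d) {p η ε : ℝ} (hε : 0 < ε)
    (hη : η = 1 / (4 * (3 ^ d * d : ℝ) ^ 2))
    (hp : 1 - p ≤ η ^ 2) {Q : Measure (Config d)} (hQ : IsBernoulli p Q) :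
    ∀ᵐ ω ∂Q, ∀ᶠ n in Filter.atTop, Good ε ω n := by
  have h : ∑' n, Q {ω | ¬ Good ε ω n} ≠ ⊤ :=
    ne_top_of_le_ne_top (summable_poly_mul_half_rpow d hε).tsum_ofReal_ne_top
      (ENNReal.tsum_le_tsum fun n => measure_not_good_le hd hη hp hQ n)
  filter_upwards [ae_eventually_notMem h] with ω hω
  filter_upwards [hω] with n hn
  simpa using hn

lemma openAdj_symm {d : ℕ} {ω : Config d} {x y : Zd d} (h : openAdj ω x y) : openAdj ω y x :=
  ⟨latAdj_symm h.1, by rw [Sym2.eq_swap]; exact h.2⟩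

lemma mem_openCompIn_self {d : ℕ} (ω : Config d) (V : Set (Zd d)) (x : Zd d) :
    x ∈ openCompIn ω V x := Relation.ReflTransGen.refl

lemma openCompIn_subset {d : ℕ} {ω : Config d} {V : Set (Zd d)} {x : Zd d} (hx : x ∈ V) :
    openCompIn ω V x ⊆ V := by
  intro y hy
  induction hy with
  | refl => exact hx
  | tail _ h _ => exact h.2.2

lemma openCompIn_closed {d : ℕ} {ω : Config d} {V : Set (Zd d)} {x a b : Zd d} (hx : x ∈ V)
    (ha : a ∈ openCompIn ω V x) (hab : openAdj ω a b) (hb : b ∈ V) : b ∈ openCompIn ω V x :=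
  Relation.ReflTransGen.tail ha ⟨hab, openCompIn_subset hx ha, hb⟩

lemma connOpen_openCompIn {d : ℕ} {ω : Config d} {V : Set (Zd d)} {x : Zd d} (hx : x ∈ V) :
    ConnOpen ω (openCompIn ω V x) := by
  have key : ∀ y ∈ openCompIn ω V x, Relation.ReflTransGen
      (fun a b => openAdj ω a b ∧ a ∈ openCompIn ω V x ∧ b ∈ openCompIn ω V x) x y := by
    intro y hy
    induction hy with
    | refl => exact .refl
    | @tail b c hb hbc ih =>
      exact ih.tail ⟨hbc.1, hb, openCompIn_closed hx hb hbc.1 hbc.2.2⟩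
  intro a ha b hb
  refine Relation.ReflTransGen.trans ?_ (key b hb)
  have := key a ha
  rw [← Relation.reflTransGen_swap] at this
  refine Relation.ReflTransGen.mono ?_ _ _ this
  exact fun u v h => ⟨openAdj_symm h.1, h.2.2, h.2.1⟩

lemma ConnOpen.connLat {d : ℕ} {ω : Config d} {A : Set (Zd d)} (h : ConnOpen ω A) : ConnLat A :=
  fun x hx y hy => Relation.ReflTransGen.mono (fun _ _ h => ⟨h.1.1, h.2⟩) _ _ (h x hx y hy)

lemma ConnOpen.exists_adj {d : ℕ} {ω : Config d} {A : Set (Zd d)} (h : ConnOpen ω A)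
    (P : Zd d → Prop) {x y : Zd d} (hx : x ∈ A) (hy : y ∈ A) (hPx : P x) (hPy : ¬ P y) :
    ∃ a ∈ A, ∃ b ∈ A, openAdj ω a b ∧ P a ∧ ¬ P b := by
  by_contra! hc
  have key : ∀ z, Relation.ReflTransGen (fun a b => openAdj ω a b ∧ a ∈ A ∧ b ∈ A) x z → P z := by
    intro z hz
    induction hz with
    | refl => exact hPx
    | @tail b c _ hbc ih => exact hc b hbc.2.1 c hbc.2.2 hbc.1 ih
  exact hPy (key y (h x hx y hy))

/-- A set all of whose points are attached to a connected subset is connected. -/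
lemma ConnLat.of_attached {d : ℕ} {A T : Set (Zd d)} (hA : ConnLat A) (hAT : A ⊆ T)
    (h : ∀ z ∈ T, ∃ C ⊆ T, ConnLat C ∧ z ∈ C ∧ (C ∩ A).Nonempty) : ConnLat T := by
  have mono : ∀ {C : Set (Zd d)} {x y : Zd d}, C ⊆ T → ConnLat C → x ∈ C → y ∈ C →
      Relation.ReflTransGen (fun a b => latAdj a b ∧ a ∈ T ∧ b ∈ T) x y := by
    intro C x y hCT hC hx hy
    exact Relation.ReflTransGen.mono (fun _ _ h => ⟨h.1, hCT h.2.1, hCT h.2.2⟩) _ _ (hC x hx y hy)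
  intro x hx y hy
  obtain ⟨C, hCT, hC, hxC, a, haC, haA⟩ := h x hx
  obtain ⟨C', hCT', hC', hyC', a', haC', haA'⟩ := h y hy
  exact (mono hCT hC hxC haC).trans ((mono hAT hA haA haA').trans (mono hCT' hC' haC' hyC'))

/-- The part of the box where the `i`-th coordinate lies between `a` and `b`. -/
def slab (d n : ℕ) (i : Fin d) (a b : ℤ) : Set (Zd d) := {x | x ∈ box d n ∧ a ≤ x i ∧ x i ≤ b}

lemma slab_subset {d n : ℕ} {i : Fin d} {a b : ℤ} : slab d n i a b ⊆ box d n := fun _ h => h.1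

lemma connLat_slab {d n : ℕ} {i : Fin d} {a b : ℤ} : ConnLat (slab d n i a b) := by
  refine connLat_of_ordConnected fun z hz y hy w hw => ⟨mem_box_of_between hz.1 hy.1 hw, ?_, ?_⟩
  · exact (le_min hz.2.1 hy.2.1).trans (hw i).1
  · exact (hw i).2.trans (max_le hz.2.2 hy.2.2)

lemma single_mem_slab {d n : ℕ} {i : Fin d} {a b t : ℤ} (ha : a ≤ t) (hb : t ≤ b)
    (hn : -(n : ℤ) ≤ t) (hn' : t ≤ n) : Pi.single i t ∈ slab d n i a b := by
  refine ⟨mem_box.2 fun j => ?_, by simpa using ha, by simpa using hb⟩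
  by_cases hj : j = i
  · subst hj; simp [hn, hn']
  · simp [hj]

lemma lt_ncard_slab {d n : ℕ} {i : Fin d} {a b : ℤ} (hab : a ≤ b) (ha : -(n : ℤ) ≤ a)
    (hb : b ≤ n) : b - a + 1 ≤ ((slab d n i a b).ncard : ℤ) := by
  have := connLat_slab.coord_lt_ncard ((box_finite d n).subset slab_subset)
    (single_mem_slab (i := i) le_rfl hab ha (hab.trans hb))
    (single_mem_slab (i := i) hab le_rfl (ha.trans hab) hb) i
  simpa using this

/-- At a good scale, one of two disjoint connected sets is small when the first one has no open
boundary. -/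
lemma Good.ncard_le_or {d n : ℕ} {ε : ℝ} {ω : Config d} (hd : 2 ≤ d) (hg : Good ε ω n)
    (hn : 1 ≤ n) (hnε : (n : ℝ) ^ ε ≤ n) {U V : Set (Zd d)} (hU : ConnLat U)
    (hUb : U ⊆ box d n) (hUne : U.Nonempty) (hV : ConnLat V) (hVb : V ⊆ box d n)
    (hVne : V.Nonempty) (hUV : Disjoint U V)
    (hcl : ∀ x ∈ U, ∀ y ∈ box d n \ U, ¬ openAdj ω x y) :
    (U.ncard : ℝ) ≤ (n : ℝ) ^ (2 * ε) ∨ (V.ncard : ℝ) ≤ (n : ℝ) ^ (2 * ε) := by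
  classical
  obtain ⟨D, hDb, hVD, hUD, hD, hF, hcut⟩ := exists_cut hU hUb hUne hV hVb hVne hUV
  have hn1 : (1 : ℝ) ≤ n := by exact_mod_cast hn
  set b := (edgeBdry n D).card with hb
  have hclosed : (edgeBdry n D).filter (fun e => ω (toSym e) = true) = ∅ := by
    refine Finset.filter_eq_empty_iff.2 fun e he ho => ?_
    obtain ⟨⟨h1, h2⟩, h3⟩ := mem_edgeBdry.1 he
    have hadj := latAdj_add_unitVec e.1 e.2
    have hop : openAdj ω e.1 (e.1 + unitVec e.2) := ⟨hadj, ho⟩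
    by_cases h4 : e.1 ∈ D
    · have h5 : e.1 + unitVec e.2 ∉ D := fun h => h3 ⟨fun _ => h, fun _ => h4⟩
      exact hcl _ (hcut _ h4 _ ⟨h2, h5⟩ hadj) _ ⟨h1, fun h => hUD.le_bot ⟨h, h4⟩⟩ (openAdj_symm hop)
    · have h5 : e.1 + unitVec e.2 ∈ D := by
        by_contra h
        exact h3 ⟨fun h' => absurd h' h4, fun h' => absurd h' h⟩
      exact hcl _ (hcut _ h5 _ ⟨h1, h4⟩ (latAdj_symm hadj)) _ ⟨h2, fun h => hUD.le_bot ⟨h, h5⟩⟩ hop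
  have hblt : (b : ℝ) < (n : ℝ) ^ ε := by
    by_contra! hc
    have := hg (edgeBdry n D) (fun e he => mem_edgesF.2 (mem_edgeBdry.1 he).1)
      (starConn_edgeBdry hDb hD hF) hc
    rw [hclosed, Finset.card_empty, mul_zero] at this
    have hb0 : (b : ℝ) = 0 := by exact_mod_cast Nat.le_zero.1 this
    have : (0 : ℝ) < (n : ℝ) ^ ε := by positivity
    linarith
  have hbn : b < n := by exact_mod_cast hblt.trans_le hnε
  have hd' : (2 : ℝ) ≤ d := by exact_mod_cast hd
  have hexp : (d : ℝ) / (d - 1) ≤ 2 := by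
    rw [div_le_iff₀ (by linarith)]; linarith
  have hpow : (b : ℝ) ^ ((d : ℝ) / (d - 1)) ≤ (n : ℝ) ^ (2 * ε) := by
    rcases Nat.eq_zero_or_pos b with h0 | h0
    · rw [h0, Nat.cast_zero, Real.zero_rpow (div_pos (by linarith) (by linarith)).ne']
      positivity
    · calc (b : ℝ) ^ ((d : ℝ) / (d - 1)) ≤ (b : ℝ) ^ (2 : ℝ) :=
            Real.rpow_le_rpow_of_exponent_le (by exact_mod_cast h0) hexp
        _ ≤ ((n : ℝ) ^ ε) ^ (2 : ℝ) := by gcongr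
        _ = _ := by rw [← Real.rpow_mul (by positivity), mul_comm]
  rcases ncard_le_or_compl_ncard_le hd hDb (by omega) with h | h
  · right
    refine le_trans ?_ (h.trans hpow)
    exact_mod_cast Set.ncard_le_ncard hVD ((box_finite d n).subset hDb)
  · left
    refine le_trans ?_ (h.trans hpow)
    refine Nat.cast_le.2 (Set.ncard_le_ncard (fun x hx => ⟨hUb hx, fun h => hUD.le_bot ⟨hx, h⟩⟩)
      ((box_finite d n).subset Set.sdiff_subset))

/-- At a good scale some open component has linear size. -/
lemma Good.exists_large {d n : ℕ} {ε : ℝ} {ω : Config d} (hd : 2 ≤ d) (hg : Good ε ω n)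
    (hn : 1 ≤ n) (hnε : (n : ℝ) ^ ε ≤ n) (hs : 2 * (n : ℝ) ^ (2 * ε) < n) :
    ∃ y ∈ box d n, n < 2 * (openCompIn ω (box d n) y).ncard := by
  let i : Fin d := ⟨0, by omega⟩
  set k : ℕ := (n + 1) / 2 with hk
  set I := slab d n i (-n) 0 with hI
  set J := slab d n i k n with hJ
  set U : Set (Zd d) := {y | ∃ a ∈ I, y ∈ openCompIn ω (box d n) a} with hU
  have hfin : ∀ {S : Set (Zd d)}, S ⊆ box d n → S.Finite := (box_finite d n).subset
  have hIU : I ⊆ U := fun a ha => ⟨a, ha, mem_openCompIn_self _ _ _⟩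
  have hUb : U ⊆ box d n := fun y ⟨a, ha, hy⟩ => openCompIn_subset ha.1 hy
  have hUc : ConnLat U := connLat_slab.of_attached hIU fun z ⟨a, ha, hz⟩ =>
    ⟨_, fun y hy => ⟨a, ha, hy⟩, (connOpen_openCompIn ha.1).connLat, hz, a,
      mem_openCompIn_self _ _ _, ha⟩
  have hI0 : (Pi.single i 0 : Zd d) ∈ I := single_mem_slab (by omega) le_rfl (by omega) (by omega)
  have hJ0 : (Pi.single i (n : ℤ) : Zd d) ∈ J :=
    single_mem_slab (by omega) le_rfl (by omega) (by omega)
  have hmeet : (J ∩ U).Nonempty := by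
    by_contra hc
    have hdisj : Disjoint U J := by
      rw [Set.disjoint_left]
      exact fun x hx hx' => hc ⟨x, hx', hx⟩
    have hIn := lt_ncard_slab (d := d) (n := n) (i := i) (a := -n) (b := 0)
      (by omega) le_rfl (by omega)
    have hUn := Set.ncard_le_ncard hIU (hfin hUb)
    have hJn := lt_ncard_slab (d := d) (n := n) (i := i) (a := k) (b := n)
      (by omega) (by omega) le_rfl
    have h := hg.ncard_le_or hd hn hnε hUc hUb ⟨_, hIU hI0⟩ connLat_slab slab_subset ⟨_, hJ0⟩ hdisj
      fun x ⟨a, ha, hx⟩ y hy hxy => hy.2 ⟨a, ha, openCompIn_closed ha.1 hx hxy hy.1⟩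
    rw [← hI] at hIn
    rw [← hJ] at hJn
    have hU2 : n < 2 * U.ncard := by omega
    have hJ2 : n < 2 * J.ncard := by omega
    have hU3 : (n : ℝ) < 2 * U.ncard := by exact_mod_cast hU2
    have hJ3 : (n : ℝ) < 2 * J.ncard := by exact_mod_cast hJ2
    rcases h with h | h
    · linarith
    · linarith
  obtain ⟨y, hyJ, a, ha, hya⟩ := hmeet
  refine ⟨a, ha.1, ?_⟩
  have h := (connOpen_openCompIn ha.1).connLat.coord_lt_ncard (hfin (openCompIn_subset ha.1))
    (mem_openCompIn_self _ _ _) hya i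
  have h1 := ha.2.2
  have h2 := hyJ.2.1
  omega

lemma IsLargestComp.lt_two_mul_ncard {d n : ℕ} {ε : ℝ} {ω : Config d} {L : Set (Zd d)}
    (hL : IsLargestComp ω n L) (hd : 2 ≤ d) (hg : Good ε ω n)
    (hn : 1 ≤ n) (hnε : (n : ℝ) ^ ε ≤ n) (hs : 2 * (n : ℝ) ^ (2 * ε) < n) :
    n < 2 * L.ncard := by
  obtain ⟨y, hy, hlt⟩ := hg.exists_large hd hn hnε hs
  have := hL.2 y hy
  omega

lemma box_mono {d m n : ℕ} (h : m ≤ n) : box d m ⊆ box d n := fun _ hx i =>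
  (hx i).trans (by exact_mod_cast h)

lemma mem_box_succ_of_latAdj {d n : ℕ} {x y : Zd d} (hx : x ∈ box d n) (h : latAdj x y) :
    y ∈ box d (n + 1) := by
  rw [mem_box] at *
  intro i
  have h1 := abs_le.1 (abs_sub_le_one_of_latAdj h i)
  have h2 := hx i
  push_cast
  omega

lemma openCompIn_mono {d : ℕ} {ω : Config d} {V W : Set (Zd d)} (h : V ⊆ W) (x : Zd d) :
    openCompIn ω V x ⊆ openCompIn ω W x := fun _ hy =>
  Relation.ReflTransGen.mono (fun _ _ h' => ⟨h'.1, h h'.2.1, h h'.2.2⟩) _ _ hy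

lemma bdryBar_finite {d n : ℕ} {ω : Config d} {L A : Set (Zd d)} (hA : A ⊆ box d n) :
    (bdryBar ω n L A).Finite :=
  (((box_finite d n).subset hA).prod (box_finite d (n + 1))).subset
    fun _ he => ⟨he.2.1.1, he.2.2.1⟩

lemma one_le_nComp {d n : ℕ} {L A : Set (Zd d)} (hAb : A ⊆ box d n) (hAne : A.Nonempty)
    (hA : ConnLat A) (hAL : Disjoint A L) : 1 ≤ nComp n L A := by
  obtain ⟨x, hx⟩ := hAne
  have hsub : A ⊆ box d n \ L := fun y hy => ⟨hAb hy, fun h => hAL.le_bot ⟨hy, h⟩⟩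
  refine (Set.ncard_pos (((box_finite d n).finite_subsets).subset ?_)).2 ⟨_, ⟨x, hsub hx, rfl⟩, x,
    hx, (latCompIn_subset hx).trans (hA.subset_latCompIn hsub hx)⟩
  rintro P ⟨⟨y, hy, rfl⟩, -⟩
  exact (latCompIn_subset hy).trans Set.sdiff_subset

/-- At a good scale, connected sets off a big open component are small. -/
lemma Good.ncard_le_of_disjoint {d n : ℕ} {ε : ℝ} {ω : Config d} (hd : 2 ≤ d) (hg : Good ε ω n)
    (hn : 1 ≤ n) (hnε : (n : ℝ) ^ ε ≤ n) {x : Zd d} (hx : x ∈ box d n)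
    (hM : (n : ℝ) ^ (2 * ε) < (openCompIn ω (box d n) x).ncard) {A : Set (Zd d)}
    (hA : ConnLat A) (hAb : A ⊆ box d n) (hAM : Disjoint (openCompIn ω (box d n) x) A) :
    (A.ncard : ℝ) ≤ (n : ℝ) ^ (2 * ε) := by
  rcases A.eq_empty_or_nonempty with rfl | hne
  · simp only [Set.ncard_empty, Nat.cast_zero]; positivity
  · exact (hg.ncard_le_or hd hn hnε (connOpen_openCompIn hx).connLat (openCompIn_subset hx)
      ⟨x, mem_openCompIn_self _ _ _⟩ hA hAb hne hAM
      fun a ha b hb hab => hb.2 (openCompIn_closed hx ha hab hb.1)).resolve_left hM.not_ge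

lemma openCompIn_subset_closureOf {d m n : ℕ} {ω : Config d} {x : Zd d} :
    openCompIn ω (box d m) x ⊆ closureOf ω (openCompIn ω (box d n) x) := fun _ hy =>
  ⟨x, mem_openCompIn_self _ _ _, Relation.ReflTransGen.mono (fun _ _ h => h.1) _ _ hy⟩

/-- Any set in the box that meets the largest component has a boundary edge. -/
lemma Good.one_le_ncard_bdryBar {d n : ℕ} {ε : ℝ} {ω : Config d} (hd : 2 ≤ d)
    (hg : Good ε ω (2 * n)) (hn : 1 ≤ n) (hnε : ((2 * n : ℕ) : ℝ) ^ ε ≤ (2 * n : ℕ))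
    (hs : 2 * ((2 * n : ℕ) : ℝ) ^ (2 * ε) < n) {x : Zd d} (hx : x ∈ box d n)
    (hL : n < 2 * (openCompIn ω (box d n) x).ncard) {A : Set (Zd d)} (hA : A ⊆ box d n)
    (hAL : (A ∩ openCompIn ω (box d n) x).Nonempty) :
    1 ≤ (bdryBar ω n (openCompIn ω (box d n) x) A).ncard := by
  set M := openCompIn ω (box d (2 * n)) x with hM
  have hbb : box d n ⊆ box d (2 * n) := box_mono (by omega)
  have hLM : openCompIn ω (box d n) x ⊆ M := openCompIn_mono hbb x
  have hMb : M ⊆ box d (2 * n) := openCompIn_subset (hbb hx)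
  have hMn : n < 2 * M.ncard :=
    hL.trans_le (Nat.mul_le_mul_left 2 (Set.ncard_le_ncard hLM ((box_finite d _).subset hMb)))
  have hMn' : (n : ℝ) < 2 * M.ncard := by exact_mod_cast hMn
  obtain ⟨a, haA, haL⟩ := hAL
  have hex : ∃ z ∈ M, z ∉ A := by
    by_contra! hc
    let i : Fin d := ⟨0, by omega⟩
    have hJ := hg.ncard_le_of_disjoint hd (by omega) hnε (hbb hx) (by rw [← hM]; linarith)
      (connLat_slab (d := d) (n := 2 * n) (i := i) (a := n + 1) (b := 2 * n)) slab_subset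
      (Set.disjoint_left.2 fun z hz hz' => by
        have h1 := (mem_box.1 (hA (hc z hz)) i).2
        have h2 := hz'.2.1
        omega)
    have hJn := lt_ncard_slab (d := d) (n := 2 * n) (i := i) (a := n + 1) (b := 2 * n)
      (by omega) (by omega) (by push_cast; omega)
    have hJn' : n ≤ (slab d (2 * n) i (n + 1) (2 * n)).ncard := by omega
    have hJn'' : (n : ℝ) ≤ (slab d (2 * n) i (n + 1) (2 * n)).ncard := by exact_mod_cast hJn'
    have : (0 : ℝ) < n := by exact_mod_cast hn
    linarith
  obtain ⟨z, hzM, hzA⟩ := hex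
  obtain ⟨u, huM, v, -, huv, huA, hvA⟩ :=
    (connOpen_openCompIn (hbb hx)).exists_adj (· ∈ A) (hLM haL) hzM haA hzA
  exact (Set.ncard_pos (bdryBar_finite hA)).2
    ⟨(u, v), huv, ⟨huA, openCompIn_subset_closureOf huM⟩,
      mem_box_succ_of_latAdj (hA huA) huv.1, hvA⟩

/-- The isoperimetric inequality for connected sets meeting the largest component. -/
lemma Good.exists_le_ncard_bdryBar {d n : ℕ} {ε : ℝ} {ω : Config d} (hd : 2 ≤ d)
    (hg : Good ε ω (2 * n)) (hn : 1 ≤ n) (hnε : ((2 * n : ℕ) : ℝ) ^ ε ≤ (2 * n : ℕ))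
    (hs : 2 * ((2 * n : ℕ) : ℝ) ^ (2 * ε) < n) {x : Zd d} (hx : x ∈ box d n)
    (hL : n < 2 * (openCompIn ω (box d n) x).ncard) {A : Set (Zd d)} (hA : A ⊆ box d n)
    (hAne : A.Nonempty) (hAc : ConnLat A) :
    ∃ b : ℕ, (A.ncard : ℝ) ≤ (b : ℝ) ^ ((d : ℝ) / (d - 1)) ∧ (((2 * n : ℕ) : ℝ) ^ ε ≤ b →
      b ≤ 2 * (bdryBar ω n (openCompIn ω (box d n) x) A).ncard) := by
  classical
  set M := openCompIn ω (box d (2 * n)) x with hM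
  have hbb : box d n ⊆ box d (2 * n) := box_mono (by omega)
  have hLM : openCompIn ω (box d n) x ⊆ M := openCompIn_mono hbb x
  have hMb : M ⊆ box d (2 * n) := openCompIn_subset (hbb hx)
  have hMn : n < 2 * M.ncard :=
    hL.trans_le (Nat.mul_le_mul_left 2 (Set.ncard_le_ncard hLM ((box_finite d _).subset hMb)))
  have hMn' : (n : ℝ) < 2 * M.ncard := by exact_mod_cast hMn
  set T : Set (Zd d) := A ∪ {y | ∃ a ∈ A, a ∉ M ∧ y ∈ latCompIn (box d (2 * n) \ M) a} with hT
  have hAT : A ⊆ T := Set.subset_union_left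
  have hsubM : ∀ {a}, a ∈ A → a ∉ M → latCompIn (box d (2 * n) \ M) a ⊆ box d (2 * n) \ M :=
    fun ha haM => latCompIn_subset ⟨hbb (hA ha), haM⟩
  have hTb : T ⊆ box d (2 * n) := by
    rintro y (hy | ⟨a, ha, haM, hy⟩)
    · exact hbb (hA hy)
    · exact (hsubM ha haM hy).1
  have hTc : ConnLat T := by
    refine hAc.of_attached hAT ?_
    rintro z (hz | ⟨a, ha, haM, hz⟩)
    · exact ⟨A, hAT, hAc, hz, z, hz, hz⟩
    · exact ⟨_, fun y hy => Or.inr ⟨a, ha, haM, hy⟩, connLat_latCompIn ⟨hbb (hA ha), haM⟩, hz, a,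
        mem_latCompIn_self _ _, ha⟩
  have hTs : Disjoint T (shell d (2 * n)) := by
    refine Set.disjoint_left.2 ?_
    rintro y (hy | ⟨a, ha, haM, hy⟩) ⟨-, i, hyi⟩
    · have h1 := hA hy i
      push_cast at hyi
      omega
    · have hCb := hsubM ha haM
      have hC := connLat_latCompIn (V := box d (2 * n) \ M) ⟨hbb (hA ha), haM⟩
      have h1 := hg.ncard_le_of_disjoint hd (by omega) hnε (hbb hx) (by rw [← hM]; linarith)
        hC (hCb.trans Set.sdiff_subset) (Set.disjoint_left.2 fun z hz hz' => (hCb hz').2 hz)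
      have hfin := (box_finite d (2 * n)).subset (hCb.trans Set.sdiff_subset)
      have h2 := hC.coord_lt_ncard hfin (mem_latCompIn_self _ _) hy i
      have h3 := hC.coord_lt_ncard hfin hy (mem_latCompIn_self _ _) i
      have h4 := mem_box.1 (hA ha) i
      have h5 : (latCompIn (box d (2 * n) \ M) a).ncard < n := by
        have : ((latCompIn (box d (2 * n) \ M) a).ncard : ℝ) < n := by
          have : (0 : ℝ) ≤ ((2 * n : ℕ) : ℝ) ^ (2 * ε) := by positivity
          linarith
        exact_mod_cast this
      rcases abs_cases (y i) with h6 | h6 <;> push_cast at hyi <;> omega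
  let i₀ : Fin d := ⟨0, by omega⟩
  have hsne : (shell d (2 * n)).Nonempty :=
    ⟨Pi.single i₀ (2 * n : ℕ), (single_mem_slab (a := -(2 * n : ℕ)) (b := (2 * n : ℕ))
      (by omega) (by omega) (by omega) (by omega)).1, i₀, by simp⟩
  obtain ⟨D, hDb, hVD, hTD, hD, hF, hcut⟩ := exists_cut hTc hTb (hAne.mono hAT)
    (connLat_shell hd (2 * n)) (fun _ h => h.1) hsne hTs
  set E := edgeBdry (2 * n) D with hE
  refine ⟨E.card, ?_, fun hb => ?_⟩
  · set S : Finset (Zd d) := (boxF d (2 * n)).filter (· ∉ D) with hS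
    have hSc : (S : Set (Zd d)) = box d (2 * n) \ D := by
      ext y
      simp [hS, mem_boxF]
    have hAS : A ⊆ (S : Set (Zd d)) := by
      rw [hSc]
      exact fun y hy => ⟨hbb (hA hy), fun h => hTD.le_bot ⟨hAT hy, h⟩⟩
    have h1 := card_le_rpow_edgeBdry hd (n := 2 * n) (S := S)
      (by rw [hSc]; exact Set.sdiff_subset) fun y hy i =>
        ⟨(2 * n : ℕ), by omega, le_rfl, fun h => (Finset.mem_filter.1 h).2 (hVD
          ⟨mem_boxF.1 (Finset.mem_filter.1 h).1, i, by simp⟩)⟩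
    rw [hSc, edgeBdry_eq_compl] at h1
    refine le_trans ?_ h1
    rw [← Set.ncard_coe_finset]
    exact_mod_cast Set.ncard_le_ncard hAS S.finite_toSet
  · refine (hg E (fun e he => mem_edgesF.2 (mem_edgeBdry.1 he).1)
      (starConn_edgeBdry hDb hD hF) hb).trans (Nat.mul_le_mul_left 2 ?_)
    have key : ∀ y u, openAdj ω y u → y ∈ box d (2 * n) → y ∉ D → u ∈ D →
        (y, u) ∈ bdryBar ω n (openCompIn ω (box d n) x) A := by
      intro y u hyu hyb hyD huD
      have hyT : y ∈ T := hcut u huD y ⟨hyb, hyD⟩ (latAdj_symm hyu.1)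
      have huT : u ∉ T := fun h => hTD.le_bot ⟨h, huD⟩
      have hub := hDb huD
      have hyM : y ∈ M := by
        by_contra hyM
        have huM : u ∉ M := fun h => hyM (openCompIn_closed (hbb hx) h (openAdj_symm hyu) hyb)
        rcases hyT with hy | ⟨a, ha, haM, hy⟩
        · exact huT (Or.inr ⟨y, hy, hyM, latCompIn_closed ⟨hyb, hyM⟩ (mem_latCompIn_self _ _)
            hyu.1 ⟨hub, huM⟩⟩)
        · exact huT (Or.inr ⟨a, ha, haM, latCompIn_closed ⟨hbb (hA ha), haM⟩ hy hyu.1 ⟨hub, huM⟩⟩)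
      have hyA : y ∈ A := hyT.resolve_right fun ⟨a, ha, haM, hy⟩ => (hsubM ha haM hy).2 hyM
      exact ⟨hyu, ⟨hyA, openCompIn_subset_closureOf hyM⟩, mem_box_succ_of_latAdj (hA hyA) hyu.1,
        fun h => huT (hAT h)⟩
    rw [← Set.ncard_coe_finset]
    refine Set.ncard_le_ncard_of_injOn
      (fun e => if e.1 ∈ D then (e.1 + unitVec e.2, e.1) else (e.1, e.1 + unitVec e.2)) ?_ ?_
      (bdryBar_finite hA)
    · intro e he
      obtain ⟨he, ho⟩ := Finset.mem_filter.1 (Finset.mem_coe.1 he)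
      obtain ⟨⟨h1, h2⟩, h3⟩ := mem_edgeBdry.1 he
      have hop : openAdj ω e.1 (e.1 + unitVec e.2) := ⟨latAdj_add_unitVec _ _, ho⟩
      split_ifs with h4
      · exact key _ _ (openAdj_symm hop) h2 (fun h => h3 ⟨fun _ => h, fun _ => h4⟩) h4
      · exact key _ _ hop h1 h4 (by
          by_contra h
          exact h3 ⟨fun h' => absurd h' h4, fun h' => absurd h' h⟩)
    · intro e _ e' _ hee
      have hsym : ∀ e : Zd d × Fin d, (fun q : Zd d × Zd d => s(q.1, q.2))
          (if e.1 ∈ D then (e.1 + unitVec e.2, e.1) else (e.1, e.1 + unitVec e.2)) = toSym e := by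
        intro e
        split_ifs
        · exact Sym2.eq_swap
        · rfl
      apply toSym_injective
      rw [← hsym, ← hsym]
      exact congrArg _ hee

/-- The growth conditions on the scale. -/
lemma eventually_scale {γ c ε : ℝ} (hc : 0 < c) (hε0 : 0 < ε) (hεγ : 4 * ε ≤ γ)
    (hε1 : 4 * ε ≤ 1) : ∀ᶠ n : ℕ in Filter.atTop,
      1 ≤ n ∧ (n : ℝ) ^ ε ≤ n ∧ 2 * (n : ℝ) ^ (2 * ε) < n ∧
      ((2 * n : ℕ) : ℝ) ^ ε ≤ (2 * n : ℕ) ∧ 2 * ((2 * n : ℕ) : ℝ) ^ (2 * ε) < n ∧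
      ((2 * n : ℕ) : ℝ) ^ (2 * ε) < c * (n : ℝ) ^ γ := by
  have h1 := (tendsto_rpow_atTop (y := 1 - 2 * ε) (by linarith)).comp
    (tendsto_natCast_atTop_atTop (R := ℝ))
  have h2 := (tendsto_rpow_atTop (y := γ - 2 * ε) (by linarith)).comp
    (tendsto_natCast_atTop_atTop (R := ℝ))
  filter_upwards [Filter.eventually_ge_atTop 1, h1.eventually_gt_atTop 4,
    h2.eventually_gt_atTop (2 / c)] with n hn hn1 hn2
  simp only [Function.comp_apply] at hn1 hn2
  have hn' : (1 : ℝ) ≤ n := by exact_mod_cast hn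
  have hn0 : (0 : ℝ) < n := by linarith
  have h2n : (1 : ℝ) ≤ (2 * n : ℕ) := by exact_mod_cast (by omega : 1 ≤ 2 * n)
  have hle : ∀ m : ℝ, 1 ≤ m → m ^ ε ≤ m := fun m hm => by
    simpa using Real.rpow_le_rpow_of_exponent_le hm (by linarith : ε ≤ 1)
  have hpos : 0 < (n : ℝ) ^ (2 * ε) := by positivity
  have hdbl : ((2 * n : ℕ) : ℝ) ^ (2 * ε) ≤ 2 * (n : ℝ) ^ (2 * ε) := by
    push_cast
    rw [Real.mul_rpow (by norm_num) hn0.le]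
    gcongr
    simpa using Real.rpow_le_rpow_of_exponent_le (by norm_num : (1 : ℝ) ≤ 2)
      (by linarith : 2 * ε ≤ 1)
  rw [Real.rpow_sub hn0, Real.rpow_one, lt_div_iff₀ hpos] at hn1
  rw [Real.rpow_sub hn0, div_lt_div_iff₀ hc hpos] at hn2
  refine ⟨hn, hle _ hn', by linarith, hle _ h2n, by linarith, by linarith⟩

/-- modified isoperimetric inequality for `p` close to 1. -/
theorem stmt7 (d : ℕ) (hd : 2 ≤ d) (γ : ℝ) (hγ : 0 < γ) :
    ∃ p0 < (1 : ℝ), ∀ p : ℝ, p0 ≤ p → p ≤ 1 →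
      ∃ β > (0 : ℝ), ∀ c > (0 : ℝ),
        ∀ Q : Measure (Config d), IsBernoulli p Q →
          ∀ᵐ ω ∂Q, ∃ N : ℕ, ∀ n ≥ N,
            ∀ L : Set (Zd d), IsLargestComp ω n L →
              ∀ A : Set (Zd d), A ⊆ box d n → A.Nonempty → ConnLat A →
                β ≤ ((nComp n L A : ℝ) + ((bdryBar ω n L A).ncard : ℝ)) /
                    fcut d γ c n (A.ncard : ℝ) := by
  set η : ℝ := 1 / (4 * (3 ^ d * d : ℝ) ^ 2) with hη
  have hη0 : 0 < η := by positivity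
  refine ⟨1 - η ^ 2, by nlinarith, fun p hp _ => ⟨1 / 2, by norm_num, fun c hc Q hQ => ?_⟩⟩
  set ε : ℝ := min γ 1 / 4 with hε
  have hε0 : 0 < ε := by positivity
  have hεγ : 4 * ε ≤ γ := by linarith [min_le_left γ 1]
  have hε1 : 4 * ε ≤ 1 := by linarith [min_le_right γ 1]
  filter_upwards [ae_eventually_good (by omega) hε0 hη (by linarith) hQ] with ω hω
  have hω2 : ∀ᶠ n in Filter.atTop, Good ε ω (2 * n) :=
    (Filter.tendsto_atTop_mono (fun n => (by simp only [id]; omega : id n ≤ 2 * n))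
      Filter.tendsto_id).eventually hω
  obtain ⟨N, hN⟩ := Filter.eventually_atTop.1 (hω.and (hω2.and (eventually_scale hc hε0 hεγ hε1)))
  refine ⟨N, fun n hn L hL A hA hAne hAc => ?_⟩
  obtain ⟨hg, hg2, hn1, hnε, hs, hnε2, hs2, hsc⟩ := hN n hn
  have hn1' : (1 : ℝ) ≤ n := by exact_mod_cast hn1
  have hLn := hL.lt_two_mul_ncard hd hg hn1 hnε hs
  have hd' : (2 : ℝ) ≤ d := by exact_mod_cast hd
  have hA1 : 1 ≤ A.ncard := (Set.ncard_pos ((box_finite d n).subset hA)).2 hAne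
  have hA1' : (1 : ℝ) ≤ A.ncard := by exact_mod_cast hA1
  obtain ⟨⟨x, hx, rfl⟩, -⟩ := hL
  set L := openCompIn ω (box d n) x
  unfold fcut
  split_ifs with hsmall
  · rw [div_one]
    have : 1 ≤ nComp n L A + (bdryBar ω n L A).ncard := by
      by_cases hAL : Disjoint A L
      · exact (one_le_nComp hA hAne hAc hAL).trans (Nat.le_add_right _ _)
      · exact (hg2.one_le_ncard_bdryBar hd hn1 hnε2 hs2 hx hLn hA
          (Set.not_disjoint_iff_nonempty_inter.1 hAL)).trans (Nat.le_add_left _ _)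
    have : (1 : ℝ) ≤ nComp n L A + (bdryBar ω n L A).ncard := by exact_mod_cast this
    linarith
  · rw [le_div_iff₀ (by positivity)]
    obtain ⟨b, hAb, hb⟩ := hg2.exists_le_ncard_bdryBar hd hn1 hnε2 hs2 hx hLn hA hAne hAc
    have hd0 : (0 : ℝ) < d - 1 := by linarith
    have hroot : (A.ncard : ℝ) ^ (1 - 1 / (d : ℝ)) ≤ b := by
      have h0 : (0 : ℝ) ≤ 1 - 1 / d := by
        rw [sub_nonneg, div_le_one (by linarith)]; linarith
      refine (Real.rpow_le_rpow (by positivity) hAb h0).trans_eq ?_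
      rw [← Real.rpow_mul (by positivity)]
      convert Real.rpow_one (b : ℝ) using 2
      field_simp
    have hhalf : (1 : ℝ) / 2 ≤ 1 - 1 / d := by
      have : (1 : ℝ) / d ≤ 1 / 2 := by gcongr
      linarith
    have hbig : ((2 * n : ℕ) : ℝ) ^ ε ≤ b := by
      calc ((2 * n : ℕ) : ℝ) ^ ε = (((2 * n : ℕ) : ℝ) ^ (2 * ε)) ^ ((1 : ℝ) / 2) := by
            rw [← Real.rpow_mul (by positivity)]; congr 1; ring
        _ ≤ (A.ncard : ℝ) ^ ((1 : ℝ) / 2) := by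
            gcongr
            linarith
        _ ≤ (A.ncard : ℝ) ^ (1 - 1 / (d : ℝ)) := Real.rpow_le_rpow_of_exponent_le hA1' hhalf
        _ ≤ b := hroot
    have hb' : (b : ℝ) ≤ 2 * (bdryBar ω n L A).ncard := by exact_mod_cast hb hbig
    have : (0 : ℝ) ≤ nComp n L A := by positivity
    linarith

end Perco
end
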